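/- arXiv:1906.11969 — 12 statements merged into one kernel-verified Lean document; each statement's English description precedes it below -/
import Mathlib

section
/- Assume the basic parameter conditions δ_L > 0, δ_R > 0, τ_L > δ_L + 1, τ_R < -(δ_R + 1). Then C₁ - D₁ = φ / ((τ_L - δ_L - 1)·(δ_R - τ_R·λ_L^u)), the denominator (τ_L - δ_L - 1)·(δ_R - τ_R·λ_L^u) is positive, and consequently C₁ > D₁ if and only if φ > 0. -/
/-- the formula for `C₁ - D₁`, positivity of its denominator, and
the equivalence `C₁ > D₁ ↔ φ > 0`. -/
theorem stmt2 (τL δL τR δR lamLs lamLu D1 S2 C1 φ : ℝ)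
    (hδL : 0 < δL) (hδR : 0 < δR)
    (hτL : τL > δL + 1) (hτR : τR < -(δR + 1))
    (hlamLs : lamLs = (τL - Real.sqrt (τL ^ 2 - 4 * δL)) / 2)
    (hlamLu : lamLu = (τL + Real.sqrt (τL ^ 2 - 4 * δL)) / 2)
    (hD1 : D1 = 1 / (1 - lamLs))
    (hS2 : S2 = -lamLu / (lamLu - 1))
    (hC1 : C1 = -S2 / (δR - τR + δR / S2))
    (hφ : φ = δR - (τR + δL + δR - (1 + τR) * lamLu) * lamLu) :
    C1 - D1 = φ / ((τL - δL - 1) * (δR - τR * lamLu)) ∧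
    0 < (τL - δL - 1) * (δR - τR * lamLu) ∧
    (C1 > D1 ↔ φ > 0) := by
  have hdisc : 0 ≤ τL ^ 2 - 4 * δL := by nlinarith [sq_nonneg (δL - 1)]
  have hsum : lamLs + lamLu = τL := by rw [hlamLs, hlamLu]; ring
  have hprod : lamLs * lamLu = δL := by
    rw [hlamLs, hlamLu]
    linear_combination (-1 / 4) * Real.sq_sqrt hdisc
  have hle : lamLs ≤ lamLu := by
    rw [hlamLs, hlamLu]
    linarith [Real.sqrt_nonneg (τL ^ 2 - 4 * δL)]
  have hfactor : τL - δL - 1 = (1 - lamLs) * (lamLu - 1) := by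
    linear_combination hprod - hsum
  have hpos : 0 < (1 - lamLs) * (lamLu - 1) := by linarith
  have hu : 0 < lamLu - 1 := by
    by_contra! h
    nlinarith
  have hs : 0 < 1 - lamLs := pos_of_mul_pos_left hpos hu.le
  have hu0 : 0 < lamLu := by linarith
  have hden : 0 < δR - τR * lamLu := by nlinarith
  have hC : C1 = lamLu ^ 2 / ((lamLu - 1) * (δR - τR * lamLu)) := by
    have hsub : δR - τR + δR / S2 = (δR - τR * lamLu) / lamLu := by
      rw [hS2]
      field_simp
      ring
    rw [hC1, hsub, hS2]
    field_simp
  have hden_pos : 0 < (τL - δL - 1) * (δR - τR * lamLu) := by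
    rw [hfactor]
    exact mul_pos hpos hden
  have hdiff : C1 - D1 = φ / ((τL - δL - 1) * (δR - τR * lamLu)) := by
    rw [hC, hD1, hfactor, hφ, ← hprod, div_sub_div _ _ (by positivity) hs.ne',
      div_eq_div_iff (by positivity) (by positivity)]
    ring
  refine ⟨hdiff, hden_pos, ?_⟩
  rw [gt_iff_lt, ← sub_pos, hdiff, div_pos_iff_of_pos_right hden_pos]
end

section
/- Assume the basic parameter conditions δ_L > 0, δ_R > 0, τ_L > δ_L + 1, τ_R < -(δ_R + 1), and also φ > 0. Then Ω is forward invariant under f, i.e., f(Ω) ⊆ Ω. -/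
/-- The 2D border-collision normal form. -/
noncomputable def bcnf (τL δL τR δR : ℝ) (p : ℝ × ℝ) : ℝ × ℝ :=
  if p.1 ≤ 0 then (τL * p.1 + p.2 + 1, -δL * p.1)
  else (τR * p.1 + p.2 + 1, -δR * p.1)

/-- Twice the signed area of the triangle `A B P`. -/
def signedArea (A B P : ℝ × ℝ) : ℝ :=
  (B.1 - A.1) * (P.2 - A.2) - (B.2 - A.2) * (P.1 - A.1)

lemma convex_setOf_signedArea_nonneg (A B : ℝ × ℝ) : Convex ℝ {P | 0 ≤ signedArea A B P} := by
  intro P hP Q hQ a b ha hb hab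
  have key : signedArea A B (a • P + b • Q) = a * signedArea A B P + b * signedArea A B Q := by
    obtain rfl : b = 1 - a := by linarith
    simp only [signedArea, Prod.fst_add, Prod.snd_add, Prod.smul_fst, Prod.smul_snd, smul_eq_mul]
    ring
  rw [Set.mem_ofPred_eq] at hP hQ ⊢
  rw [key]
  positivity

/-- A positively oriented triangle is the intersection of the half-planes to the left of its
edges. -/
lemma mem_convexHull_triangle_iff {A B C : ℝ × ℝ} (h : 0 < signedArea A B C) (P : ℝ × ℝ) :
    P ∈ convexHull ℝ {A, B, C} ↔
      0 ≤ signedArea A B P ∧ 0 ≤ signedArea B C P ∧ 0 ≤ signedArea C A P := by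
  have cyclic₁ : signedArea B C A = signedArea A B C := by simp only [signedArea]; ring
  have cyclic₂ : signedArea C A B = signedArea A B C := by simp only [signedArea]; ring
  have degenerate : ∀ U V : ℝ × ℝ, signedArea U V U = 0 ∧ signedArea U V V = 0 := fun U V =>
    ⟨by simp only [signedArea]; ring, by simp only [signedArea]; ring⟩
  constructor
  · have hsub : convexHull ℝ {A, B, C} ⊆ {P | 0 ≤ signedArea A B P} ∩
        ({P | 0 ≤ signedArea B C P} ∩ {P | 0 ≤ signedArea C A P}) := by
      refine convexHull_min ?_ ((convex_setOf_signedArea_nonneg A B).inter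
        ((convex_setOf_signedArea_nonneg B C).inter (convex_setOf_signedArea_nonneg C A)))
      rintro Q (rfl | rfl | rfl) <;>
        simp [degenerate, cyclic₁, cyclic₂, h.le]
    exact fun hP => hsub hP
  · rintro ⟨hAB, hBC, hCA⟩
    have hne := h.ne'
    have hsum : signedArea B C P / signedArea A B C + signedArea C A P / signedArea A B C
        + signedArea A B P / signedArea A B C = 1 := by
      rw [← add_div, ← add_div, div_eq_one_iff_eq hne]
      simp only [signedArea]
      ring
    have hP : (signedArea B C P / signedArea A B C) • A +
        (signedArea C A P / signedArea A B C) • B +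
        (signedArea A B P / signedArea A B C) • C = P := by
      ext <;>
        simp only [Prod.fst_add, Prod.snd_add, Prod.smul_fst, Prod.smul_snd, smul_eq_mul] <;>
        field_simp <;> simp only [signedArea] <;> ring
    rw [← hP]
    have hconv := convex_convexHull ℝ {A, B, C}
    have mem : ∀ Q ∈ ({A, B, C} : Set (ℝ × ℝ)), Q ∈ convexHull ℝ {A, B, C} :=
      fun Q hQ => subset_convexHull ℝ _ hQ
    have := hconv.sum_mem (t := Finset.univ)
      (w := ![signedArea B C P / signedArea A B C, signedArea C A P / signedArea A B C,
        signedArea A B P / signedArea A B C]) (z := ![A, B, C])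
      (by intro i _; fin_cases i <;> simp <;> positivity)
      (by simpa [Fin.sum_univ_three] using hsum)
      (by intro i _; fin_cases i <;> exact mem _ (by simp))
    simpa [Fin.sum_univ_three] using this

/-- The half-plane description of the triangle with vertices `D = (X, 0)`, `f(D) = F` and a
third vertex `B` lying on the line through `D` of slope `-s` and on the line through `F` of
slope `-u`. -/
lemma mem_convexHull_iff_of_slopes {τ δ s u X : ℝ} (hδ : 0 < δ) (hτ : τ < -(δ + 1))
    (hs : 0 < s) (hs1 : s < 1) (hu : 1 < u) (hX : X * (1 - s) = 1) {B D F : ℝ × ℝ}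
    (hD : D = (X, 0)) (hF : F = (τ * X + 1, -δ * X))
    (hBD : B.2 = -s * (B.1 - X)) (hBF : F.2 - B.2 = -u * (F.1 - B.1)) (P : ℝ × ℝ) :
    P ∈ convexHull ℝ {B, D, F} ↔
      P.2 + s * P.1 ≤ s * X ∧ -δ * X + u * (τ * X + 1) ≤ P.2 + u * P.1 ∧
        δ * (P.1 - X) ≤ (s - τ) * P.2 := by
  obtain ⟨x, y⟩ := B
  obtain ⟨x', y'⟩ := P
  subst hD hF
  simp only at hBD hBF ⊢
  have hXpos : 0 < X := by nlinarith
  have hk : 0 < τ * X + 1 - x := by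
    have h : (u - s) * (τ * X + 1 - x) = X * (δ - s * τ + s ^ 2) := by
      linear_combination s * hX + hBF + hBD
    have hpos : 0 < X * (δ - s * τ + s ^ 2) := by
      have : 0 < -τ := by linarith
      have := mul_pos hs this
      apply mul_pos hXpos
      nlinarith [sq_nonneg s]
    exact pos_of_mul_pos_right (h ▸ hpos) (by linarith)
  have ht : 0 < s - τ := by linarith
  have hn : 0 < X - x := by nlinarith [mul_pos hXpos ht]
  have h₁ : signedArea (x, y) (τ * X + 1, -δ * X) (x', y') =
      (τ * X + 1 - x) * (y' + u * x' - (-δ * X + u * (τ * X + 1))) := by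
    simp only [signedArea]
    linear_combination (-(x' - x) + (τ * X + 1 - x)) * hBF
  have h₂ : signedArea (τ * X + 1, -δ * X) (X, 0) (x', y') =
      X * ((s - τ) * y' - δ * (x' - X)) := by
    simp only [signedArea]
    linear_combination y' * hX
  have h₃ : signedArea (X, 0) (x, y) (x', y') = (X - x) * (s * X - (y' + s * x')) := by
    simp only [signedArea]
    linear_combination (-(x' - X)) * hBD
  have harea : 0 < signedArea (x, y) (τ * X + 1, -δ * X) (X, 0) := by
    have : signedArea (x, y) (τ * X + 1, -δ * X) (X, 0) = (τ * X + 1 - x) * ((u - s) * (X - x)) := by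
      simp only [signedArea]
      linear_combination (-(X - x)) * hBF - (τ * X + 1 - x) * hBD
    rw [this]
    exact mul_pos hk (mul_pos (by linarith) hn)
  rw [Set.pair_comm, mem_convexHull_triangle_iff harea, h₁, h₂, h₃,
    mul_nonneg_iff_of_pos_left hk, mul_nonneg_iff_of_pos_left hXpos,
    mul_nonneg_iff_of_pos_left hn, sub_nonneg, sub_nonneg, sub_nonneg]
  tauto

/-- The eigenvalues of the left piece of the normal form, which has a saddle fixed point. -/
lemma eigenvalues_of_saddle {τ δ s u : ℝ} (hδ : 0 < δ) (hτ : δ + 1 < τ)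
    (hs : s = (τ - Real.sqrt (τ ^ 2 - 4 * δ)) / 2)
    (hu : u = (τ + Real.sqrt (τ ^ 2 - 4 * δ)) / 2) :
    s + u = τ ∧ s * u = δ ∧ 0 < s ∧ s < 1 ∧ 1 < u := by
  have hsq : Real.sqrt (τ ^ 2 - 4 * δ) ^ 2 = τ ^ 2 - 4 * δ :=
    Real.sq_sqrt (by nlinarith [sq_nonneg (δ - 1)])
  have hr := Real.sqrt_nonneg (τ ^ 2 - 4 * δ)
  have hsum : s + u = τ := by rw [hs, hu]; ring
  have hprod : s * u = δ := by rw [hs, hu]; linear_combination (-1 / 4) * hsq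
  have hle : s ≤ u := by rw [hs, hu]; linarith
  have hupos : 0 < u := by linarith
  have hspos : 0 < s := pos_of_mul_pos_left (hprod ▸ hδ) hupos.le
  have hlt : (1 - s) * (1 - u) < 0 := by nlinarith
  have hs1 : s < 1 := by
    by_contra! h
    nlinarith [mul_nonneg (sub_nonneg.2 h) (sub_nonneg.2 (h.trans hle))]
  exact ⟨hsum, hprod, hspos, hs1, by nlinarith⟩

/-- The half-planes cutting out `Ω` are jointly preserved by the normal form. -/
lemma bcnf_preserves_halfplanes {τ δ s u X : ℝ} (hδ : 0 < δ) (hτ : τ < -(δ + 1))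
    (hs : 0 < s) (hs1 : s < 1) (hu : 1 < u) (hX : X * (1 - s) = 1)
    (hq : 0 < (u - 1) * (-δ * X + u * (τ * X + 1)) + u) {P : ℝ × ℝ}
    (h₁ : P.2 + s * P.1 ≤ s * X) (h₂ : -δ * X + u * (τ * X + 1) ≤ P.2 + u * P.1)
    (h₃ : δ * (P.1 - X) ≤ (s - τ) * P.2) :
    (bcnf (s + u) (s * u) τ δ P).2 + s * (bcnf (s + u) (s * u) τ δ P).1 ≤ s * X ∧
      -δ * X + u * (τ * X + 1) ≤
        (bcnf (s + u) (s * u) τ δ P).2 + u * (bcnf (s + u) (s * u) τ δ P).1 ∧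
      δ * ((bcnf (s + u) (s * u) τ δ P).1 - X) ≤ (s - τ) * (bcnf (s + u) (s * u) τ δ P).2 := by
  obtain ⟨x, y⟩ := P
  simp only at h₁ h₂ h₃
  have ht : 0 < s - τ := by linarith
  have hupos : 0 < u := by linarith
  by_cases hx : x ≤ 0
  · simp only [bcnf, hx, if_true]
    have hy : 0 ≤ -(s * u) * x := by nlinarith [mul_pos hs hupos]
    have hp : -(s * u) * x + s * ((s + u) * x + y + 1) ≤ s * X := by
      nlinarith [mul_le_mul_of_nonneg_left h₁ hs.le]
    refine ⟨hp, ?_, ?_⟩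
    · nlinarith [mul_le_mul_of_nonneg_left h₂ hupos.le]
    · have hxX : (s + u) * x + y + 1 ≤ X := le_of_mul_le_mul_left (by linarith) hs
      nlinarith [mul_nonneg ht.le hy, mul_nonneg hδ.le (sub_nonneg.2 hxX)]
  · have hx0 : 0 < x := not_le.1 hx
    simp only [bcnf, hx, if_false]
    have hxX : x ≤ X := by
      have h : (δ + s * (s - τ)) * (x - X) ≤ 0 := by
        nlinarith [mul_le_mul_of_nonneg_left h₁ ht.le]
      have hpos : 0 < δ + s * (s - τ) := by positivity
      nlinarith
    refine ⟨?_, ?_, ?_⟩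
    · have : 0 ≤ (s * (s - τ) + δ) * x := by positivity
      nlinarith [mul_le_mul_of_nonneg_left h₁ hs.le]
    · have hcoef : 0 ≤ -(s - τ) * τ - δ := by nlinarith
      have hscaled : 0 ≤ (s - τ) * (-δ * x + u * (τ * x + y + 1) - (-δ * X + u * (τ * X + 1))) := by
        nlinarith [mul_le_mul_of_nonneg_left h₃ hupos.le,
          mul_nonneg (mul_nonneg hupos.le hcoef) (sub_nonneg.2 hxX),
          mul_nonneg (mul_nonneg ht.le hδ.le) (sub_nonneg.2 hxX)]
      linarith [(mul_nonneg_iff_of_pos_left ht).1 hscaled]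
    · nlinarith [mul_le_mul_of_nonneg_left h₁ hδ.le]

/-- the triangle `Ω = B D f(D)` is forward invariant under `f`. -/
theorem stmt3 (τL δL τR δR lamLs lamLu : ℝ)
    (hδL : 0 < δL) (hδR : 0 < δR)
    (hτL : τL > δL + 1) (hτR : τR < -(δR + 1))
    (hlamLs : lamLs = (τL - Real.sqrt (τL ^ 2 - 4 * δL)) / 2)
    (hlamLu : lamLu = (τL + Real.sqrt (τL ^ 2 - 4 * δL)) / 2)
    (hφ : 0 < δR - (τR + δL + δR - (1 + τR) * lamLu) * lamLu)
    (Y D S B : ℝ × ℝ)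
    (hY : Y = (-1 / (τL - δL - 1), δL / (τL - δL - 1)))
    (hD : D = (1 / (1 - lamLs), 0))
    (hS : S = (0, -lamLu / (lamLu - 1)))
    (hB1 : B ∈ segment ℝ Y D)
    (hB2 : (bcnf τL δL τR δR D).2 - B.2 = -lamLu * ((bcnf τL δL τR δR D).1 - B.1)) :
    bcnf τL δL τR δR '' (convexHull ℝ {B, D, bcnf τL δL τR δR D}) ⊆
      convexHull ℝ {B, D, bcnf τL δL τR δR D} := by
  obtain ⟨hsum, hprod, hs, hs1, hu⟩ := eigenvalues_of_saddle hδL hτL hlamLs hlamLu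
  have hs1' : 0 < 1 - lamLs := sub_pos.2 hs1
  have hX : 1 / (1 - lamLs) * (1 - lamLs) = 1 := by field_simp
  set X := 1 / (1 - lamLs) with hXdef
  have hXpos : 0 < X := by positivity
  have hF : bcnf τL δL τR δR D = (τR * X + 1, -δR * X) := by
    simp [hD, bcnf, hXpos.not_ge]
  have hBD : B.2 = -lamLs * (B.1 - X) := by
    obtain ⟨a, b, -, -, hab, rfl⟩ := hB1
    have hY' : Y.2 = -lamLs * (Y.1 - X) := by
      have hden : τL - δL - 1 = (1 - lamLs) * (lamLu - 1) := by rw [← hsum, ← hprod]; ring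
      have hu' : lamLu - 1 ≠ 0 := by linarith
      rw [hY, hden, ← hprod, hXdef]
      field_simp
      ring
    simp only [hD, Prod.fst_add, Prod.snd_add, Prod.smul_fst, Prod.smul_snd, smul_eq_mul]
    obtain rfl : b = 1 - a := by linarith
    linear_combination a * hY'
  have hq : 0 < (lamLu - 1) * (-δR * X + lamLu * (τR * X + 1)) + lamLu := by
    rw [← hprod] at hφ
    have := mul_pos hXpos hφ
    linear_combination this + (lamLu ^ 2) * hX
  have hΩ := mem_convexHull_iff_of_slopes hδR hτR hs hs1 hu hX hD hF hBD hB2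
  rintro _ ⟨P, hP, rfl⟩
  rw [hΩ] at hP ⊢
  rw [← hsum, ← hprod]
  exact bcnf_preserves_halfplanes hδR hτR hs hs1 hu hX hq hP.1 hP.2.1 hP.2.2
end

section
/- Assume the basic parameter conditions δ_L > 0, δ_R > 0, τ_L > δ_L + 1, τ_R < -(δ_R + 1), and also φ > 0. Then there exists ε₀ > 0 such that for all ε with 0 < ε ≤ ε₀, the triangle Ω_trap(ε) is a trapping region: f(Ω_trap(ε)) is contained in the interior of Ω_trap(ε). -/
/-- The closed triangle with vertices `(d, 0)`, `(0, c)` and the intersection of the line of slope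
`-s` through the former with the line of slope `-u` through the latter, as an intersection of
half-planes. -/
def slopeTriangle (u s c d : ℝ) : Set (ℝ × ℝ) :=
  {p | c ≤ u * p.1 + p.2 ∧ s * p.1 + p.2 ≤ s * d ∧ c * (d - p.1) ≤ d * p.2}

/-- The strict version of `slopeTriangle`. -/
def openSlopeTriangle (u s c d : ℝ) : Set (ℝ × ℝ) :=
  {p | c < u * p.1 + p.2 ∧ s * p.1 + p.2 < s * d ∧ c * (d - p.1) < d * p.2}

theorem isOpen_openSlopeTriangle (u s c d : ℝ) : IsOpen (openSlopeTriangle u s c d) := by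
  unfold openSlopeTriangle
  refine IsOpen.and ?_ (IsOpen.and ?_ ?_) <;> exact isOpen_lt (by fun_prop) (by fun_prop)

theorem openSlopeTriangle_subset (u s c d : ℝ) :
    openSlopeTriangle u s c d ⊆ slopeTriangle u s c d :=
  fun _ h => ⟨h.1.le, h.2.1.le, h.2.2.le⟩

theorem convex_slopeTriangle (u s c d : ℝ) : Convex ℝ (slopeTriangle u s c d) := by
  rintro ⟨x, y⟩ ⟨h₁, h₂, h₃⟩ ⟨x', y'⟩ ⟨k₁, k₂, k₃⟩ α β hα hβ hαβ
  obtain rfl : β = 1 - α := by linarith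
  simp only [slopeTriangle, Set.mem_ofPred_eq, Prod.fst_add, Prod.snd_add, Prod.smul_fst,
    Prod.smul_snd, smul_eq_mul] at *
  refine ⟨?_, ?_, ?_⟩
  · linear_combination α * h₁ + (1 - α) * k₁
  · linear_combination α * h₂ + (1 - α) * k₂
  · linear_combination α * h₃ + (1 - α) * k₃

theorem convexHull_eq_slopeTriangle {u s c d : ℝ} (hs : 0 < s) (hsu : s < u) (hc : c < 0)
    (hd : 0 < d) {P : ℝ × ℝ} (hPu : u * P.1 + P.2 = c) (hPs : s * P.1 + P.2 = s * d) :
    convexHull ℝ {P, (d, 0), (0, c)} = slopeTriangle u s c d := by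
  obtain ⟨x, y⟩ := P
  simp only at hPu hPs
  have hsd : 0 < s * d := mul_pos hs hd
  have hx : x < 0 := by nlinarith
  have hy : 0 < y := by nlinarith
  apply subset_antisymm
  · refine convexHull_min ?_ (convex_slopeTriangle u s c d)
    rintro p (rfl | rfl | rfl)
    · refine ⟨hPu.ge, hPs.le, ?_⟩
      show c * (d - x) ≤ d * y
      nlinarith [mul_pos hd hy, mul_pos (neg_pos.2 hc) (by linarith : 0 < d - x)]
    · refine ⟨?_, ?_, ?_⟩ <;> simp
      nlinarith
    · refine ⟨?_, ?_, ?_⟩ <;> simp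
      · linarith
      · linarith
  · rintro ⟨p, q⟩ ⟨h₁, h₂, h₃⟩
    simp only at h₁ h₂ h₃
    have hU : 0 < u * d - c := by nlinarith
    have hS : 0 < s * d - c := by linarith
    have hus : 0 < u - s := by linarith
    obtain rfl : y = c - u * x := by linarith
    obtain rfl : x = (c - s * d) / (u - s) := by
      rw [eq_div_iff hus.ne']; linarith
    have key := (convex_convexHull ℝ {((c - s * d) / (u - s), c - u * ((c - s * d) / (u - s))),
      (d, (0 : ℝ)), ((0 : ℝ), c)}).sum_mem (t := Finset.univ)
      (w := ![(u - s) * (d * q - c * (d - p)) / ((u * d - c) * (s * d - c)),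
        (u * p + q - c) / (u * d - c), (s * d - (s * p + q)) / (s * d - c)])
      (z := ![((c - s * d) / (u - s), c - u * ((c - s * d) / (u - s))), (d, 0), (0, c)])
      (by
        intro i _
        fin_cases i
        · exact div_nonneg (mul_nonneg hus.le (sub_nonneg.2 h₃)) (mul_pos hU hS).le
        · exact div_nonneg (sub_nonneg.2 h₁) hU.le
        · exact div_nonneg (sub_nonneg.2 h₂) hS.le)
      (by simp [Fin.sum_univ_three]; field_simp; ring)
      (by intro i _; apply subset_convexHull; fin_cases i <;> simp)
    convert key using 1
    simp only [Fin.sum_univ_three, Matrix.cons_val, Prod.smul_mk, Prod.mk_add_mk, smul_eq_mul,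
      Prod.mk.injEq]
    constructor <;> field_simp <;> ring

theorem one_lt_and_neg_of_intercept_bounds {u s c d τR δR : ℝ} (hs : 0 < s) (hs1 : s < 1)
    (hu : 1 < u) (hδR : 0 < δR) (hτR : τR < -(δR + 1)) (hd : 1 < d * (1 - s))
    (hcd : c < u * (τR * d + 1) - δR * d) : 1 < d ∧ c < 0 := by
  have hd1 : 1 < d := by nlinarith
  refine ⟨hd1, ?_⟩
  nlinarith [mul_pos (by linarith : 0 < u) (by nlinarith : 0 < -(τR * d + 1))]

/-- If `0 < s < 1 < u` are the multipliers of the left piece, the normal form maps the closed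
triangle into the open one. -/
theorem bcnf_mem_openSlopeTriangle {u s c d τR δR : ℝ} (hs : 0 < s) (hs1 : s < 1) (hu : 1 < u)
    (hδR : 0 < δR) (hτR : τR < -(δR + 1)) (hd : 1 < d * (1 - s)) (hc : -u < (u - 1) * c)
    (hcd : c < u * (τR * d + 1) - δR * d) {p : ℝ × ℝ} (hp : p ∈ slopeTriangle u s c d) :
    bcnf (u + s) (u * s) τR δR p ∈ openSlopeTriangle u s c d := by
  obtain ⟨x, y⟩ := p
  obtain ⟨h₁, h₂, h₃⟩ := hp
  simp only at h₁ h₂ h₃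
  obtain ⟨hd1, hc0⟩ := one_lt_and_neg_of_intercept_bounds hs hs1 hu hδR hτR hd hcd
  unfold bcnf
  split_ifs with hx
  · simp only at hx
    have hb : s * ((u + s) * x + y + 1) + -(u * s) * x < s * d := by nlinarith
    have hy' : 0 ≤ -(u * s) * x := by nlinarith [mul_pos (by linarith : 0 < u) hs]
    refine ⟨?_, hb, ?_⟩
    · show c < u * ((u + s) * x + y + 1) + -(u * s) * x
      nlinarith
    · show c * (d - ((u + s) * x + y + 1)) < d * (-(u * s) * x)
      have : 0 < d - ((u + s) * x + y + 1) := by nlinarith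
      nlinarith
  · simp only [not_le] at hx
    have hxd : x ≤ d := by
      by_contra! h
      nlinarith [mul_pos hs (sub_pos.2 h), mul_pos (neg_pos.2 hc0) (sub_pos.2 h),
        mul_pos (by linarith : 0 < d) (mul_pos hs (sub_pos.2 h))]
    have hτx : τR * x ≤ 0 := by nlinarith
    refine ⟨?_, ?_, ?_⟩
    · show c < u * (τR * x + y + 1) + -δR * x
      have key : 0 < d * (u * (τR * x + y + 1) + -δR * x - c) := by
        nlinarith [mul_le_mul_of_nonneg_left h₃ (by linarith : 0 ≤ u),
          mul_pos hx (sub_pos.2 hcd), mul_nonneg (sub_nonneg.2 hxd) (by linarith : 0 ≤ (u-1)*c + u)]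
      nlinarith [pos_of_mul_pos_right key (by linarith)]
    · show s * (τR * x + y + 1) + -δR * x < s * d
      have : s * (τR * x + y + 1) < s * d := by
        apply mul_lt_mul_of_pos_left _ hs
        nlinarith
      nlinarith
    · show c * (d - (τR * x + y + 1)) < d * (-δR * x)
      have h0 : 0 < -c * (d * (1 - s) - 1) := mul_pos (by linarith) (by linarith)
      have hD : δR * d * d < -c * (d - τR * d - 1) := by
        have e1 : δR * d < -c := by
          nlinarith [mul_pos (by linarith : 0 < u) (by nlinarith : 0 < -(τR * d + 1))]
        have e2 : d < d - τR * d - 1 := by nlinarith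
        exact mul_lt_mul e1 e2.le (by linarith) (by linarith)
      have key : 0 < d * (d * (-δR * x) - c * (d - (τR * x + (s * d - s * x) + 1))) := by
        nlinarith [mul_pos hx (sub_pos.2 hD), mul_nonneg (sub_nonneg.2 hxd) h0.le]
      have := pos_of_mul_pos_right key (by linarith)
      nlinarith

/-- The multipliers of a saddle with positive eigenvalues, and its trace and determinant in terms
of them. -/
theorem multipliers_of_saddle {τ δ s u : ℝ} (hδ : 0 < δ) (hτ : τ > δ + 1)
    (hs : s = (τ - Real.sqrt (τ ^ 2 - 4 * δ)) / 2)
    (hu : u = (τ + Real.sqrt (τ ^ 2 - 4 * δ)) / 2) :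
    0 < s ∧ s < 1 ∧ 1 < u ∧ τ = u + s ∧ δ = u * s := by
  have hsq := Real.sq_sqrt (show 0 ≤ τ ^ 2 - 4 * δ by nlinarith [sq_nonneg (δ - 1)])
  have h0 := Real.sqrt_nonneg (τ ^ 2 - 4 * δ)
  have hsum : τ = u + s := by rw [hs, hu]; ring
  have hprod : δ = u * s := by rw [hs, hu]; linear_combination hsq / 4
  have hsu : s ≤ u := by linarith
  have hu0 : 0 < u := by linarith
  have hs0 : 0 < s := pos_of_mul_pos_right (hprod ▸ hδ) hu0.le
  have hneg : 0 < (u - 1) * (1 - s) := by nlinarith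
  have hs1 : s < 1 := by
    by_contra! h
    nlinarith [mul_nonneg (sub_nonneg.2 (h.trans hsu)) (sub_nonneg.2 h)]
  exact ⟨hs0, hs1, by linarith [pos_of_mul_pos_left hneg (by linarith)], hsum, hprod⟩

/-- Perturbing the intercepts `1 / (1 - s)` and `(u * (τR + 1 - s) - δR) / (1 - s)` by terms of
orders `ε ^ 2` and `ε` gives a triangle to which `bcnf_mem_openSlopeTriangle` applies. -/
theorem exists_forall_intercept_bounds {u s τR δR k e : ℝ} (hs : 0 < s) (hs1 : s < 1)
    (hu : 1 < u) (hδR : 0 < δR) (hτR : τR < -(δR + 1))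
    (hφ : 0 < δR - (τR + u * s + δR - (1 + τR) * u) * u) (hk : 0 < k) (he : 0 < e) :
    ∃ ε₀ > 0, ∀ ε : ℝ, 0 < ε → ε ≤ ε₀ → ∀ c d : ℝ,
      c = (u * (τR + 1 - s) - δR) / (1 - s) - ε * k → d = 1 / (1 - s) + ε ^ 2 * e →
      1 < d * (1 - s) ∧ -u < (u - 1) * c ∧ c < u * (τR * d + 1) - δR * d := by
  have h1s : 0 < 1 - s := by linarith
  have hu1 : 0 < u - 1 := by linarith
  obtain ⟨A, hA⟩ : ∃ t, t = (u * (τR + 1 - s) - δR) / (1 - s) := ⟨_, rfl⟩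
  obtain ⟨w, hw⟩ : ∃ t, t = δR - u * τR := ⟨_, rfl⟩
  have hAY : 0 < A + u / (u - 1) := by
    have : A + u / (u - 1) =
        (δR - (τR + u * s + δR - (1 + τR) * u) * u) / ((1 - s) * (u - 1)) := by
      rw [hA]; field_simp; ring
    rw [this]; positivity
  have hw0 : 0 < w := by nlinarith
  refine ⟨min ((A + u / (u - 1)) / (2 * k)) (k / (2 * (e * w))), by positivity, ?_⟩
  rintro ε hε hε₀ c d hc hd
  rw [← hA] at hc
  have hε₁ := (le_div_iff₀ (by positivity)).1 (hε₀.trans (min_le_left _ _))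
  have hε₂ := (le_div_iff₀ (by positivity)).1 (hε₀.trans (min_le_right _ _))
  have hεk := mul_pos hε hk
  refine ⟨?_, ?_, ?_⟩
  · have : d * (1 - s) = 1 + ε ^ 2 * e * (1 - s) := by rw [hd]; field_simp
    have : 0 < ε ^ 2 * e * (1 - s) := by positivity
    linarith
  · have h : 0 < (u - 1) * (c + u / (u - 1)) := mul_pos hu1 (by linarith)
    have : (u - 1) * (c + u / (u - 1)) = (u - 1) * c + u := by field_simp
    linarith
  · have : u * (τR * d + 1) - δR * d = A - ε * (ε * (e * w)) := by
      rw [hd, hA, hw]; field_simp; ring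
    rw [this, hc]
    have : ε * (e * w) < k := by nlinarith [mul_pos hε (mul_pos he hw0)]
    linarith [mul_lt_mul_of_pos_left this hε]

/-- for all sufficiently small `ε > 0` the triangle
`Ω_trap(ε) = B_ε D_ε F_ε` is a trapping region: it maps into its interior. -/
theorem stmt4 (τL δL τR δR lamLs lamLu : ℝ)
    (hδL : 0 < δL) (hδR : 0 < δR)
    (hτL : τL > δL + 1) (hτR : τR < -(δR + 1))
    (hlamLs : lamLs = (τL - Real.sqrt (τL ^ 2 - 4 * δL)) / 2)
    (hlamLu : lamLu = (τL + Real.sqrt (τL ^ 2 - 4 * δL)) / 2)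
    (hφ : 0 < δR - (τR + δL + δR - (1 + τR) * lamLu) * lamLu)
    (Y D S B : ℝ × ℝ)
    (hY : Y = (-1 / (τL - δL - 1), δL / (τL - δL - 1)))
    (hD : D = (1 / (1 - lamLs), 0))
    (hS : S = (0, -lamLu / (lamLu - 1)))
    (hB1 : B ∈ segment ℝ Y D)
    (hB2 : (bcnf τL δL τR δR D).2 - B.2 = -lamLu * ((bcnf τL δL τR δR D).1 - B.1)) :
    ∃ ε₀ > 0, ∀ ε : ℝ, 0 < ε → ε ≤ ε₀ →
      ∀ Bε Dε Fε : ℝ × ℝ,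
        Bε = B - ε • (D - Y) - ε ^ 2 • (S - Y) →
        Dε.2 = 0 → Dε.2 - Bε.2 = -lamLs * (Dε.1 - Bε.1) →
        Fε.1 = 0 → Fε.2 - Bε.2 = -lamLu * (Fε.1 - Bε.1) →
        bcnf τL δL τR δR '' (convexHull ℝ {Bε, Dε, Fε}) ⊆
          interior (convexHull ℝ {Bε, Dε, Fε}) := by
  obtain ⟨hs, hs1, hu, rfl, rfl⟩ := multipliers_of_saddle hδL hτL hlamLs hlamLu
  clear hlamLs hlamLu hτL hδL
  rename' lamLs => s, lamLu => u
  have h1s : 0 < 1 - s := by linarith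
  have hu1 : 0 < u - 1 := by linarith
  have hden : u + s - u * s - 1 = (u - 1) * (1 - s) := by ring
  rw [hden] at hY
  have hYs : s * Y.1 + Y.2 = s / (1 - s) := by
    rw [hY]; field_simp; ring
  have hYu : u * Y.1 + Y.2 = -(u / (u - 1)) := by
    rw [hY]; field_simp; ring
  have hDs : s * D.1 + D.2 = s / (1 - s) := by
    rw [hD]; field_simp; ring
  have hDu : u * D.1 + D.2 = u / (1 - s) := by
    rw [hD]; field_simp; ring
  have hSs : s * S.1 + S.2 = -(u / (u - 1)) := by
    rw [hS]; field_simp; ring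
  have hSu : u * S.1 + S.2 = -(u / (u - 1)) := by
    rw [hS]; field_simp; ring
  have hBs : s * B.1 + B.2 = s / (1 - s) := by
    obtain ⟨α, β, -, -, hαβ, rfl⟩ := hB1
    simp only [Prod.fst_add, Prod.snd_add, Prod.smul_fst, Prod.smul_snd, smul_eq_mul]
    linear_combination α * hYs + β * hDs + s / (1 - s) * hαβ
  have hBu : u * B.1 + B.2 = (u * (τR + 1 - s) - δR) / (1 - s) := by
    have hpos : ¬ 1 / (1 - s) ≤ 0 := not_le.2 (by positivity)
    rw [hD] at hB2
    simp only [bcnf, if_neg hpos] at hB2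
    have : u * B.1 + B.2 = u * (τR * (1 / (1 - s)) + 0 + 1) + -δR * (1 / (1 - s)) := by
      linear_combination -hB2
    rw [this]; field_simp; ring
  obtain ⟨k, hk⟩ : ∃ t, t = u / (1 - s) + u / (u - 1) := ⟨_, rfl⟩
  obtain ⟨e, he⟩ : ∃ t, t = (s / (1 - s) + u / (u - 1)) / s := ⟨_, rfl⟩
  have hk0 : 0 < k := by rw [hk]; positivity
  have he0 : 0 < e := by rw [he]; positivity
  obtain ⟨ε₀, hε₀, h⟩ := exists_forall_intercept_bounds hs hs1 hu hδR hτR hφ hk0 he0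
  refine ⟨ε₀, hε₀, ?_⟩
  rintro ε hε hle P ⟨d, _⟩ ⟨_, c⟩ hP (rfl : _ = (0 : ℝ)) hPD (rfl : _ = (0 : ℝ)) hPF
  have hPs : s * P.1 + P.2 = s * d := by linear_combination -hPD
  have hPu : u * P.1 + P.2 = c := by linear_combination -hPF
  have hse : s * e = s / (1 - s) + u / (u - 1) := by rw [he]; field_simp
  have hd : d = 1 / (1 - s) + ε ^ 2 * e := by
    apply mul_left_cancel₀ hs.ne'
    rw [← hPs, hP]
    simp only [Prod.fst_sub, Prod.snd_sub, Prod.smul_fst, Prod.smul_snd, smul_eq_mul]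
    linear_combination hBs - ε * (hDs - hYs) - ε ^ 2 * (hSs - hYs) - ε ^ 2 * hse
  have hc : c = (u * (τR + 1 - s) - δR) / (1 - s) - ε * k := by
    rw [← hPu, hP, hk]
    simp only [Prod.fst_sub, Prod.snd_sub, Prod.smul_fst, Prod.smul_snd, smul_eq_mul]
    linear_combination hBu - ε * (hDu - hYu) - ε ^ 2 * (hSu - hYu)
  obtain ⟨hd', hc', hcd⟩ := h ε hε hle c d hc hd
  obtain ⟨hd1, hc0⟩ := one_lt_and_neg_of_intercept_bounds hs hs1 hu hδR hτR hd' hcd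
  rw [convexHull_eq_slopeTriangle hs (hs1.trans hu) hc0 (by linarith) hPu hPs]
  rintro _ ⟨p, hp, rfl⟩
  exact interior_maximal (openSlopeTriangle_subset u s c d) (isOpen_openSlopeTriangle u s c d)
    (bcnf_mem_openSlopeTriangle hs hs1 hu hδR hτR hd' hc' hcd hp)
end

section
/- Suppose δ > 0 and |τ| > δ + 1. Then |q(τ,δ)| < |p(τ,δ)| < |r(τ,δ)|. -/
/-- if `δ > 0` and `|τ| > δ + 1` then `|q| < |p| < |r|`. -/
theorem stmt5 (τ δ q r p : ℝ) (hδ : 0 < δ) (hτ : |τ| > δ + 1)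
    (hq : q = -(τ / 2) * (1 - Real.sqrt (1 - 4 * δ / τ ^ 2)))
    (hr : r = -(τ / 2) * (1 + Real.sqrt (1 - 4 * δ / τ ^ 2)))
    (hp : p = -(τ ^ 2 + δ ^ 2 - 1) / (2 * τ)) :
    |q| < |p| ∧ |p| < |r| := by
  have hT : 0 < |τ| := by linarith
  have hτ2 : 0 < τ ^ 2 := by rw [← sq_abs]; positivity
  have hsq : (δ + 1) ^ 2 < τ ^ 2 := by
    rw [← sq_abs τ]
    gcongr
  have hdisc : 0 ≤ 1 - 4 * δ / τ ^ 2 := by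
    rw [sub_nonneg, div_le_one hτ2]
    nlinarith [sq_nonneg (δ - 1)]
  have hs0 := Real.sqrt_nonneg (1 - 4 * δ / τ ^ 2)
  have hs2 := Real.sq_sqrt hdisc
  have hs1 : √(1 - 4 * δ / τ ^ 2) ≤ 1 :=
    Real.sqrt_le_one.mpr (by linarith [show 0 < 4 * δ / τ ^ 2 by positivity])
  set s := √(1 - 4 * δ / τ ^ 2)
  have hN : 0 < τ ^ 2 + δ ^ 2 - 1 := by nlinarith
  have hq' : |q| = τ ^ 2 * (1 - s) / (2 * |τ|) := by
    rw [hq, abs_mul, abs_neg, abs_div, abs_two, abs_of_nonneg (sub_nonneg.mpr hs1), ← sq_abs τ]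
    field_simp
  have hr' : |r| = τ ^ 2 * (1 + s) / (2 * |τ|) := by
    rw [hr, abs_mul, abs_neg, abs_div, abs_two, abs_of_nonneg (by linarith : 0 ≤ 1 + s),
      ← sq_abs τ]
    field_simp
  have hp' : |p| = (τ ^ 2 + δ ^ 2 - 1) / (2 * |τ|) := by
    rw [hp, abs_div, abs_neg, abs_mul, abs_two, abs_of_pos hN]
  have hkey : |δ ^ 2 - 1| < τ ^ 2 * s := by
    refine abs_lt_of_sq_lt_sq ?_ (by positivity)
    have h : (τ ^ 2 * s) ^ 2 = τ ^ 2 * τ ^ 2 - 4 * δ * τ ^ 2 := by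
      have hτ0 : τ ≠ 0 := abs_pos.mp hT
      rw [mul_pow, hs2]
      field_simp
    rw [h]
    nlinarith [mul_pos (sub_pos.mpr hsq) (add_pos_of_pos_of_nonneg hτ2 (sq_nonneg (δ - 1)))]
  obtain ⟨h₁, h₂⟩ := abs_lt.mp hkey
  rw [hq', hr', hp']
  constructor
  · gcongr
    linarith
  · gcongr
    linarith
end

section
/- Suppose δ > 0 and |τ| > δ + 1. Then the derivative of G satisfies G'(m) = δ/(τ + m)² > 0 for all m ≠ -τ, and G'(q(τ,δ)) < 1. -/
/-- the slope map `G(m) = -δ/(τ+m)` has derivative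
`δ/(τ+m)² > 0` at every `m ≠ -τ`, and `G'(q(τ,δ)) < 1`. -/
theorem stmt6 (τ δ q : ℝ) (hδ : 0 < δ) (hτ : |τ| > δ + 1)
    (hq : q = -(τ / 2) * (1 - Real.sqrt (1 - 4 * δ / τ ^ 2))) :
    (∀ m : ℝ, m ≠ -τ →
      HasDerivAt (fun x : ℝ => -δ / (τ + x)) (δ / (τ + m) ^ 2) m ∧
      0 < δ / (τ + m) ^ 2) ∧
    δ / (τ + q) ^ 2 < 1 := by
  refine ⟨fun m hm => ?_, ?_⟩
  · have hne : τ + m ≠ 0 := fun h => hm (by linarith)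
    refine ⟨?_, by positivity⟩
    have h := (hasDerivAt_const m (-δ)).fun_div ((hasDerivAt_id m).const_add τ) hne
    simpa using h
  · have hτδ : 4 * δ < τ ^ 2 := by
      rw [← sq_abs]
      nlinarith [sq_nonneg (δ - 1)]
    have hs := Real.sqrt_nonneg (1 - 4 * δ / τ ^ 2)
    set s := Real.sqrt (1 - 4 * δ / τ ^ 2)
    have hsq : (τ + q) ^ 2 = τ ^ 2 / 4 + τ ^ 2 / 4 * (2 * s + s ^ 2) := by
      rw [hq]
      ring
    have hlt : δ < (τ + q) ^ 2 := by
      have : 0 ≤ τ ^ 2 / 4 * (2 * s + s ^ 2) := by positivity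
      linarith
    exact (div_lt_one (hδ.trans hlt)).2 hlt
end

section
/- Suppose δ > 0, |τ| > δ + 1, and |τ| > (δ + 2)/√2. If m ∈ ℝ is such that |m - τ| ≤ |q(τ,δ) - τ|, then ‖A·v‖ > √2·‖v‖, where A is the 2×2 matrix with rows (τ, 1) and (-δ, 0), v = (1, m), and ‖·‖ is the Euclidean norm on ℝ². -/
/-- The Euclidean norm on `Fin 2 → ℝ`. -/
noncomputable def euclNorm (v : Fin 2 → ℝ) : ℝ := Real.sqrt (v 0 ^ 2 + v 1 ^ 2)

/-- if `|m - τ| ≤ |q(τ,δ) - τ|` then `‖A v‖ > √2 ‖v‖`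
for `v = (1, m)`. -/
theorem stmt8 (τ δ q m : ℝ) (hδ : 0 < δ) (hτ : |τ| > δ + 1)
    (hτ2 : |τ| > (δ + 2) / Real.sqrt 2)
    (hq : q = -(τ / 2) * (1 - Real.sqrt (1 - 4 * δ / τ ^ 2)))
    (hm : |m - τ| ≤ |q - τ|) :
    euclNorm ((!![τ, 1; -δ, 0]).mulVec ![1, m]) > Real.sqrt 2 * euclNorm ![1, m] := by
  have hT1 : (δ + 1) ^ 2 < τ ^ 2 := by
    rw [← sq_abs τ]
    gcongr
  have hT2 : (δ + 2) ^ 2 < 2 * τ ^ 2 := by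
    have h : ((δ + 2) / Real.sqrt 2) ^ 2 < |τ| ^ 2 := by gcongr
    rw [sq_abs, div_pow, Real.sq_sqrt (by norm_num)] at h
    linarith
  have hT : 0 < τ ^ 2 := lt_trans (by positivity) hT1
  have hT4 : 4 * δ < τ ^ 2 := by nlinarith [sq_nonneg (δ - 1)]
  set s := Real.sqrt (1 - 4 * δ / τ ^ 2) with hs
  have hs0 : 0 ≤ s := Real.sqrt_nonneg _
  have hs2 : τ ^ 2 * s ^ 2 = τ ^ 2 - 4 * δ := by
    rw [hs, Real.sq_sqrt (sub_nonneg.2 ((div_le_one hT).2 hT4.le)), mul_sub,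
      mul_div_cancel₀ _ hT.ne', mul_one]
  have hm2 : (m - τ) ^ 2 ≤ (q - τ) ^ 2 := sq_le_sq.2 hm
  have hq2 : (q - τ) ^ 2 = 3 * (τ ^ 2 * (1 - s) / 2) - δ + τ ^ 2 := by
    rw [hq]
    linear_combination hs2 / 4
  -- `τ² (1 - s) / 2` is the smaller root of `x² - τ² x + δ τ²`, which is negative at `c`.
  have hc : τ ^ 2 * (1 - s) / 2 < (τ ^ 2 + δ ^ 2 + δ - 2) / 3 := by
    set c := (τ ^ 2 + δ ^ 2 + δ - 2) / 3 with hc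
    have hneg : c ^ 2 - τ ^ 2 * c + δ * τ ^ 2 < 0 := by
      have h : 0 < (2 * τ ^ 2 - (δ + 2) ^ 2) * (τ ^ 2 + (δ - 1) ^ 2) :=
        mul_pos (by linarith) (by positivity)
      rw [hc]
      linarith
    have hfac : (c - τ ^ 2 * (1 - s) / 2) * (c - τ ^ 2 * (1 + s) / 2) < 0 := by
      linear_combination hneg - τ ^ 2 / 4 * hs2
    by_contra! hle
    have hTs : 0 ≤ τ ^ 2 * s := by positivity
    exact absurd hfac (not_lt.2 (mul_nonneg_of_nonpos_of_nonpos (by linarith) (by linarith)))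
  unfold euclNorm
  rw [← Real.sqrt_mul (by norm_num)]
  apply Real.sqrt_lt_sqrt (by positivity)
  simp [Matrix.mulVec, dotProduct, Fin.sum_univ_two]
  linarith
end

section
/- Assume the basic parameter conditions δ_L > 0, δ_R > 0, τ_L > δ_L + 1, τ_R < -(δ_R + 1). Then the cone Ψ_K with K = [q_L, q_R] is invariant and expanding for both A_L and A_R: (i) A_L·v ∈ Ψ_K and A_R·v ∈ Ψ_K for all v ∈ Ψ_K, and (ii) there exists c > 1 such that ‖A_L·v‖ ≥ c·‖v‖ and ‖A_R·v‖ ≥ c·‖v‖ for all v ∈ Ψ_K. If additionally τ_L > (δ_L + 2)/√2 and τ_R < -(δ_R + 2)/√2, then the constant c can be chosen with c > √2. -/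
/-- The cone `Ψ_K` of vectors `a • (1, m)` with `m ∈ [qL, qR]`. -/
def coneK (qL qR : ℝ) : Set (Fin 2 → ℝ) :=
  {v | ∃ a m : ℝ, m ∈ Set.Icc qL qR ∧ v = a • ![1, m]}

/-- The smaller root `-q` and the larger root `τ + q` of `x ^ 2 - τ * x + δ` lie on either side of
every `r > 0` at which this polynomial is negative. -/
lemma eigen_slope_bounds {τ δ q r : ℝ} (hδ : 0 < δ) (hτ : δ + 1 < τ)
    (hq : q = -(τ / 2) * (1 - Real.sqrt (1 - 4 * δ / τ ^ 2))) (hr : r ^ 2 + δ < τ * r) :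
    q ^ 2 + τ * q + δ = 0 ∧ q < 0 ∧ -r < q ∧ r < τ + q := by
  have hτ0 : 0 < τ := by linarith
  have hdisc : 0 ≤ 1 - 4 * δ / τ ^ 2 := by
    rw [sub_nonneg, div_le_one (by positivity)]
    nlinarith [sq_nonneg (δ - 1)]
  set s := Real.sqrt (1 - 4 * δ / τ ^ 2)
  have hs0 : 0 ≤ s := Real.sqrt_nonneg _
  have hs2 : s ^ 2 = 1 - 4 * δ / τ ^ 2 := Real.sq_sqrt hdisc
  have hτs : τ ^ 2 * s ^ 2 = τ ^ 2 - 4 * δ := by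
    rw [hs2]
    field_simp
  have hroot : q ^ 2 + τ * q + δ = 0 := by
    rw [hq]
    linear_combination hτs / 4
  have hlt : -q ≤ τ + q := by
    rw [hq]
    nlinarith [mul_nonneg hτ0.le hs0]
  have hq0 : q < 0 := by nlinarith
  have hprod : (r + q) * (r - (τ + q)) < 0 := by nlinarith
  rcases mul_neg_iff.mp hprod with h | h
  · exact ⟨hroot, hq0, by linarith [h.1], by linarith [h.2]⟩
  · linarith [h.1, h.2]

/-- The slope map `m ↦ -δ / (τ + m)` sends slopes above its fixed point `q` into `[q, 0]`. -/
lemma slope_map_mem_Icc {τ δ q m : ℝ} (hδ : 0 < δ) (hroot : q ^ 2 + τ * q + δ = 0) (hq : q < 0)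
    (hpos : 0 < τ + q) (hm : q ≤ m) : -δ / (τ + m) ∈ Set.Icc q 0 := by
  have h : 0 < τ + m := by linarith
  refine ⟨?_, div_nonpos_of_nonpos_of_nonneg (by linarith) h.le⟩
  rw [le_div_iff₀ h]
  nlinarith

/-- Vectors of slope between `q` and `1` are stretched by a squared factor at least
`min ((τ + q) ^ 2) 3`, where `τ + q` is the eigenvalue of the eigenvector `(1, q)`. -/
lemma sq_expansion {τ δ q m k : ℝ} (hroot : q ^ 2 + τ * q + δ = 0) (hq : q < 0)
    (hτ : 1 < τ) (hm : q ≤ m) (hm1 : m ≤ 1) (hk1 : 1 ≤ k) (hk3 : k ≤ 3)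
    (hk : k ≤ (τ + q) ^ 2) : k * (1 + m ^ 2) ≤ (τ + m) ^ 2 + δ ^ 2 := by
  have hδ : δ = -(q * (τ + q)) := by linarith
  have hcoef : 0 ≤ 2 * τ - (k - 1) * (m + q) := by nlinarith
  have h1 := mul_nonneg (sub_nonneg.2 hm) hcoef
  have h2 := mul_nonneg (sub_nonneg.2 hk) (by positivity : 0 ≤ 1 + q ^ 2)
  rw [hδ]
  linarith

lemma mulVec_smul_slope (τ δ a m : ℝ) :
    (!![τ, 1; -δ, 0] : Matrix (Fin 2) (Fin 2) ℝ).mulVec (a • ![1, m]) =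
      a • ![τ + m, -δ] := by
  ext i
  fin_cases i <;> simp [Matrix.mulVec, dotProduct, Fin.sum_univ_two] <;> ring

lemma smul_mem_coneK {qL qR a x y : ℝ} (hx : x ≠ 0) (h : y / x ∈ Set.Icc qL qR) :
    a • ![x, y] ∈ coneK qL qR := by
  refine ⟨a * x, y / x, h, ?_⟩
  ext i
  fin_cases i
  · simp
  · simp
    field_simp

lemma sqrt_mul_euclNorm_le {k a m x y : ℝ} (hk : 0 ≤ k) (h : k * (1 + m ^ 2) ≤ x ^ 2 + y ^ 2) :
    Real.sqrt k * euclNorm (a • ![1, m]) ≤ euclNorm (a • ![x, y]) := by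
  rw [euclNorm, euclNorm, ← Real.sqrt_mul hk]
  apply Real.sqrt_le_sqrt
  simp only [Pi.smul_apply, Matrix.cons_val_zero, Matrix.cons_val_one, smul_eq_mul]
  nlinarith [mul_le_mul_of_nonneg_left h (sq_nonneg a)]

/-- `Ψ_K` with `K = [q_L, q_R]` is an invariant expanding cone for
both `A_L` and `A_R`; under the additional conditions the expansion constant
can be chosen greater than `√2`. -/
theorem stmt9 (τL δL τR δR qL qR : ℝ)
    (hδL : 0 < δL) (hδR : 0 < δR)
    (hτL : τL > δL + 1) (hτR : τR < -(δR + 1))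
    (AL AR : Matrix (Fin 2) (Fin 2) ℝ)
    (hAL : AL = !![τL, 1; -δL, 0]) (hAR : AR = !![τR, 1; -δR, 0])
    (hqL : qL = -(τL / 2) * (1 - Real.sqrt (1 - 4 * δL / τL ^ 2)))
    (hqR : qR = -(τR / 2) * (1 - Real.sqrt (1 - 4 * δR / τR ^ 2))) :
    (∀ v ∈ coneK qL qR, AL.mulVec v ∈ coneK qL qR ∧ AR.mulVec v ∈ coneK qL qR) ∧
    (∃ c > 1, ∀ v ∈ coneK qL qR,
      euclNorm (AL.mulVec v) ≥ c * euclNorm v ∧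
      euclNorm (AR.mulVec v) ≥ c * euclNorm v) ∧
    (τL > (δL + 2) / Real.sqrt 2 → τR < -((δR + 2) / Real.sqrt 2) →
      ∃ c > Real.sqrt 2, ∀ v ∈ coneK qL qR,
        euclNorm (AL.mulVec v) ≥ c * euclNorm v ∧
        euclNorm (AR.mulVec v) ≥ c * euclNorm v) := by
  have hqR' : -qR = -(-τR / 2) * (1 - Real.sqrt (1 - 4 * δR / (-τR) ^ 2)) := by
    rw [hqR, neg_sq]
    ring
  obtain ⟨hrootL, hqL0, hqL1, hlamL⟩ :=
    eigen_slope_bounds (r := 1) hδL hτL hqL (by linarith)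
  obtain ⟨hrootR, hqR0, hqR1, hlamR⟩ :=
    eigen_slope_bounds (τ := -τR) (r := 1) hδR (by linarith) hqR' (by linarith)
  subst hAL hAR
  have expand : ∀ k, 1 ≤ k → k ≤ 3 → k ≤ (τL + qL) ^ 2 → k ≤ (-τR + -qR) ^ 2 →
      ∀ v ∈ coneK qL qR,
        euclNorm ((!![τL, 1; -δL, 0] : Matrix (Fin 2) (Fin 2) ℝ).mulVec v) ≥
          Real.sqrt k * euclNorm v ∧
        euclNorm ((!![τR, 1; -δR, 0] : Matrix (Fin 2) (Fin 2) ℝ).mulVec v) ≥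
          Real.sqrt k * euclNorm v := by
    rintro k hk1 hk3 hkL hkR _ ⟨a, m, ⟨hmL, hmR⟩, rfl⟩
    rw [mulVec_smul_slope, mulVec_smul_slope]
    have hk0 : 0 ≤ k := by linarith
    refine ⟨sqrt_mul_euclNorm_le hk0 ?_, sqrt_mul_euclNorm_le hk0 ?_⟩
    · linarith [sq_expansion (τ := τL) (m := m) hrootL hqL0 (by linarith) hmL (by linarith) hk1 hk3 hkL]
    · linarith [sq_expansion (τ := -τR) (q := -qR) (m := -m) hrootR hqR0 (by linarith)
        (by linarith) (by linarith) hk1 hk3 hkR]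
  have bound : ∀ b : ℝ, 1 ≤ b → b < 3 → b < (τL + qL) ^ 2 → b < (-τR + -qR) ^ 2 →
      ∃ c > Real.sqrt b, ∀ v ∈ coneK qL qR,
        euclNorm ((!![τL, 1; -δL, 0] : Matrix (Fin 2) (Fin 2) ℝ).mulVec v) ≥ c * euclNorm v ∧
        euclNorm ((!![τR, 1; -δR, 0] : Matrix (Fin 2) (Fin 2) ℝ).mulVec v) ≥
          c * euclNorm v := by
    intro b hb1 hb3 hbL hbR
    obtain ⟨k, hbk, hk⟩ := exists_between (lt_min hb3 (lt_min hbL hbR))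
    obtain ⟨hk3, hk⟩ := lt_min_iff.1 hk
    obtain ⟨hkL, hkR⟩ := lt_min_iff.1 hk
    exact ⟨Real.sqrt k, Real.sqrt_lt_sqrt (by linarith) hbk,
      expand k (by linarith) hk3.le hkL.le hkR.le⟩
  refine ⟨?_, ?_, ?_⟩
  · rintro _ ⟨a, m, ⟨hmL, hmR⟩, rfl⟩
    rw [mulVec_smul_slope, mulVec_smul_slope]
    constructor
    · have h := slope_map_mem_Icc hδL hrootL hqL0 (by linarith) hmL
      exact smul_mem_coneK (by linarith : 0 < τL + m).ne' ⟨h.1, by linarith [h.2]⟩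
    · have h := slope_map_mem_Icc (m := -m) hδR hrootR hqR0 (by linarith) (by linarith)
      rw [← neg_add, neg_div_neg_eq, ← neg_neg (δR / (τR + m)), ← neg_div] at h
      exact smul_mem_coneK (by linarith : τR + m < 0).ne ⟨by linarith [h.2], by linarith [h.1]⟩
  · simpa using bound 1 le_rfl (by norm_num) (by nlinarith) (by nlinarith)
  · intro hL hR
    have h2 : Real.sqrt 2 ^ 2 = 2 := Real.sq_sqrt (by norm_num)
    have hpos : 0 < Real.sqrt 2 := by positivity
    rw [gt_iff_lt, div_lt_iff₀ hpos] at hL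
    rw [lt_neg, div_lt_iff₀ hpos] at hR
    obtain ⟨-, -, -, hL'⟩ := eigen_slope_bounds (r := Real.sqrt 2) hδL hτL hqL (by linarith)
    obtain ⟨-, -, -, hR'⟩ :=
      eigen_slope_bounds (τ := -τR) (r := Real.sqrt 2) hδR (by linarith) hqR' (by linarith)
    exact bound 2 (by norm_num) (by norm_num) (by nlinarith) (by nlinarith)
end

section
/- Assume the basic parameter conditions δ_L > 0, δ_R > 0, τ_L > δ_L + 1, τ_R < -(δ_R + 1). Then every periodic solution of f is Lyapunov unstable: if z ∈ ℝ² satisfies f^n(z) = z for some n ≥ 1, then there exists ε > 0 such that for every δ > 0 there exist a point w with ‖w - z‖ ≤ δ and an integer k ≥ 0 with ‖f^k(w) - f^k(z)‖ > ε. -/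
/-- The Euclidean norm on `ℝ × ℝ`. -/
noncomputable def euclNormP (v : ℝ × ℝ) : ℝ := Real.sqrt (v.1 ^ 2 + v.2 ^ 2)

/-- A slope interval `[-a, b]` whose cone is invariant under both linear branches of the map and in
which the first coordinate is expanded by a factor `c > 1`. -/
theorem exists_invariant_expanding_slopes {τL δL τR δR : ℝ} (hδL : 0 < δL) (hδR : 0 < δR)
    (hτL : τL > δL + 1) (hτR : τR < -(δR + 1)) :
    ∃ a b c : ℝ, 0 ≤ a ∧ 0 ≤ b ∧ 1 < c ∧ c ≤ τL - a ∧ c ≤ -τR - b ∧ δL ≤ a * c ∧ δR ≤ b * c := by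
  obtain ⟨η, hη, hη1, hηL, hηR⟩ : ∃ η : ℝ, 0 < η ∧ η ≤ 1 / 2 ∧ 2 * η ≤ τL - 1 - δL ∧
      2 * η ≤ -τR - 1 - δR := by
    have h1 := min_le_left 1 (min (τL - 1 - δL) (-τR - 1 - δR))
    have h2 := min_le_right 1 (min (τL - 1 - δL) (-τR - 1 - δR))
    have h3 := min_le_left (τL - 1 - δL) (-τR - 1 - δR)
    have h4 := min_le_right (τL - 1 - δL) (-τR - 1 - δR)
    have h5 : 0 < min 1 (min (τL - 1 - δL) (-τR - 1 - δR)) :=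
      lt_min one_pos (lt_min (by linarith) (by linarith))
    exact ⟨min 1 (min (τL - 1 - δL) (-τR - 1 - δR)) / 2, by linarith, by linarith, by linarith,
      by linarith⟩
  exact ⟨τL - 1 - η, -τR - 1 - η, 1 + η, by linarith, by linarith, by linarith, by linarith,
    by linarith, by nlinarith, by nlinarith⟩

/-- The image of a cone vector under a linear map `(x, y) ↦ (τ x + y, -δ x)` is again a cone
vector. -/
theorem exists_slope_image {τ δ a b c m x : ℝ} (hc : 1 < c) (ha : 0 ≤ a) (hb : 0 ≤ b)
    (hδ : 0 < δ) (h : c ≤ τ + m ∧ δ ≤ a * c ∨ τ + m ≤ -c ∧ δ ≤ b * c) :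
    (∃ m' : ℝ, -a ≤ m' ∧ m' ≤ b ∧ -δ * x = m' * (τ * x + m * x)) ∧
      c * |x| ≤ |τ * x + m * x| := by
  have hne : τ + m ≠ 0 := by
    rcases h with ⟨h, -⟩ | ⟨h, -⟩ <;> intro h0 <;> linarith
  refine ⟨⟨-δ / (τ + m), ?_, ?_, by field_simp⟩, ?_⟩
  · rcases h with ⟨h, h'⟩ | ⟨h, h'⟩
    · rw [le_div_iff₀ (by linarith)]; nlinarith
    · rw [le_div_iff_of_neg (by linarith)]; nlinarith
  · rcases h with ⟨h, h'⟩ | ⟨h, h'⟩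
    · rw [div_le_iff₀ (by linarith)]; nlinarith
    · rw [div_le_iff_of_neg (by linarith)]; nlinarith
  · rw [← add_mul, abs_mul]
    gcongr
    rcases h with ⟨h, -⟩ | ⟨h, -⟩
    · exact h.trans (le_abs_self _)
    · exact (by linarith : c ≤ -(τ + m)).trans (neg_le_abs _)

theorem bcnf_of_nonpos {τL δL τR δR : ℝ} {p : ℝ × ℝ} (hp : p.1 ≤ 0) :
    bcnf τL δL τR δR p = (τL * p.1 + p.2 + 1, -δL * p.1) := if_pos hp

theorem bcnf_of_nonneg {τL δL τR δR : ℝ} {p : ℝ × ℝ} (hp : 0 ≤ p.1) :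
    bcnf τL δL τR δR p = (τR * p.1 + p.2 + 1, -δR * p.1) := by
  rcases hp.eq_or_lt with h | h
  · simp [bcnf, ← h]
  · exact if_neg h.not_ge

/-- Two points on a common closed side of the switching line, with difference in the cone. -/
theorem bcnf_sub_mem_cone {τL δL τR δR a b c : ℝ} (hδL : 0 < δL) (hδR : 0 < δR) (ha : 0 ≤ a)
    (hb : 0 ≤ b) (hc : 1 < c) (hcL : c ≤ τL - a) (hcR : c ≤ -τR - b) (haL : δL ≤ a * c)
    (hbR : δR ≤ b * c) {p q : ℝ × ℝ} (hpq : p.1 ≤ 0 ∧ q.1 ≤ 0 ∨ 0 ≤ p.1 ∧ 0 ≤ q.1)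
    (h : ∃ m : ℝ, -a ≤ m ∧ m ≤ b ∧ (p - q).2 = m * (p - q).1) :
    (∃ m : ℝ, -a ≤ m ∧ m ≤ b ∧ (bcnf τL δL τR δR p - bcnf τL δL τR δR q).2 =
        m * (bcnf τL δL τR δR p - bcnf τL δL τR δR q).1) ∧
      c * |(p - q).1| ≤ |(bcnf τL δL τR δR p - bcnf τL δL τR δR q).1| := by
  obtain ⟨m, hm1, hm2, hm⟩ := h
  obtain ⟨τ, δ, h1, h2, hδ, hcase⟩ : ∃ τ δ : ℝ,
      (bcnf τL δL τR δR p - bcnf τL δL τR δR q).1 = τ * (p - q).1 + m * (p - q).1 ∧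
      (bcnf τL δL τR δR p - bcnf τL δL τR δR q).2 = -δ * (p - q).1 ∧ 0 < δ ∧
      (c ≤ τ + m ∧ δ ≤ a * c ∨ τ + m ≤ -c ∧ δ ≤ b * c) := by
    rw [← hm]
    rcases hpq with ⟨hp, hq⟩ | ⟨hp, hq⟩
    · refine ⟨τL, δL, ?_, ?_, hδL, Or.inl ⟨by linarith, haL⟩⟩ <;>
        simp only [bcnf_of_nonpos hp, bcnf_of_nonpos hq, Prod.fst_sub, Prod.snd_sub] <;> ring
    · refine ⟨τR, δR, ?_, ?_, hδR, Or.inr ⟨by linarith, hbR⟩⟩ <;>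
        simp only [bcnf_of_nonneg hp, bcnf_of_nonneg hq, Prod.fst_sub, Prod.snd_sub] <;> ring
  rw [h1, h2]
  exact exists_slope_image hc ha hb hδ hcase

theorem exists_pos_forall_lt_eq_zero_or_le_abs (u : ℕ → ℝ) (N : ℕ) :
    ∃ ε > 0, ∀ k < N, u k = 0 ∨ ε ≤ |u k| := by
  induction N with
  | zero => exact ⟨1, one_pos, by simp⟩
  | succ N ih =>
    obtain ⟨ε, hε, h⟩ := ih
    by_cases h0 : u N = 0
    · refine ⟨ε, hε, fun k hk => ?_⟩
      rcases Nat.lt_succ_iff_lt_or_eq.mp hk with hk | rfl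
      · exact h k hk
      · exact Or.inl h0
    · refine ⟨min ε |u N|, lt_min hε (abs_pos.mpr h0), fun k hk => ?_⟩
      rcases Nat.lt_succ_iff_lt_or_eq.mp hk with hk | rfl
      · exact (h k hk).imp_right (min_le_left _ _).trans
      · exact Or.inr (min_le_right _ _)

theorem abs_fst_le_euclNormP (v : ℝ × ℝ) : |v.1| ≤ euclNormP v :=
  Real.abs_le_sqrt (by nlinarith [sq_nonneg v.2])

/-- every periodic solution of `f` is Lyapunov unstable. -/
theorem stmt12 (τL δL τR δR : ℝ)
    (hδL : 0 < δL) (hδR : 0 < δR)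
    (hτL : τL > δL + 1) (hτR : τR < -(δR + 1))
    (z : ℝ × ℝ) (n : ℕ) (hn : 1 ≤ n)
    (hz : (bcnf τL δL τR δR)^[n] z = z) :
    ∃ ε > 0, ∀ δ > 0, ∃ w : ℝ × ℝ, ∃ k : ℕ,
      euclNormP (w - z) ≤ δ ∧
      euclNormP ((bcnf τL δL τR δR)^[k] w - (bcnf τL δL τR δR)^[k] z) > ε := by
  obtain ⟨a, b, c, ha, hb, hc, hcL, hcR, haL, hbR⟩ :=
    exists_invariant_expanding_slopes hδL hδR hτL hτR
  set f := bcnf τL δL τR δR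
  obtain ⟨ε, hε, h⟩ := exists_pos_forall_lt_eq_zero_or_le_abs (fun k => (f^[k] z).1) n
  have hside : ∀ k, (f^[k] z).1 = 0 ∨ ε ≤ |(f^[k] z).1| := fun k => by
    have hp : Function.IsPeriodicPt f n z := hz
    rw [← hp.iterate_mod_apply k]
    exact h _ (Nat.mod_lt _ hn)
  refine ⟨ε, hε, fun δ hδ => ⟨z + (δ, 0), ?_⟩⟩
  by_contra! hcon
  have hnear : ∀ k, euclNormP (f^[k] (z + (δ, 0)) - f^[k] z) ≤ ε := fun k =>
    hcon k (by simp [euclNormP, Real.sqrt_sq hδ.le])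
  have hgrow : ∀ k, (∃ m : ℝ, -a ≤ m ∧ m ≤ b ∧ (f^[k] (z + (δ, 0)) - f^[k] z).2 =
      m * (f^[k] (z + (δ, 0)) - f^[k] z).1) ∧
      c ^ k * δ ≤ |(f^[k] (z + (δ, 0)) - f^[k] z).1| := by
    intro k
    induction k with
    | zero => exact ⟨⟨0, by linarith, hb, by simp⟩, by simp [le_abs_self]⟩
    | succ k ih =>
      have hd := abs_le.mp ((abs_fst_le_euclNormP _).trans (hnear k))
      simp only [Function.iterate_succ_apply']
      have key := bcnf_sub_mem_cone hδL hδR ha hb hc hcL hcR haL hbR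
        (p := f^[k] (z + (δ, 0))) (q := f^[k] z) ?_ ih.1
      · refine ⟨key.1, le_trans ?_ key.2⟩
        rw [pow_succ', mul_assoc]
        exact mul_le_mul_of_nonneg_left ih.2 (by linarith)
      · rw [Prod.fst_sub] at hd
        rcases hside k with h0 | h0
        · rw [h0]
          simpa using le_total _ _
        · rcases le_abs.mp h0 with h0 | h0
          · exact Or.inr ⟨by linarith, by linarith⟩
          · exact Or.inl ⟨by linarith, by linarith⟩
  obtain ⟨k, hk⟩ := pow_unbounded_of_one_lt (ε / δ) hc
  rw [div_lt_iff₀ hδ] at hk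
  linarith [(hgrow k).2, abs_fst_le_euclNormP (f^[k] (z + (δ, 0)) - f^[k] z), hnear k]
end

section
/- Assume the basic parameter conditions δ_L > 0, δ_R > 0, τ_L > δ_L + 1, τ_R < -(δ_R + 1), the additional conditions τ_L > (δ_L + 2)/√2 and τ_R < -(δ_R + 2)/√2, and φ > 0. Then f²(T) lies strictly to the left of the stable eigenline E^s(X); that is, writing f²(T) = (a, b), one has b > X₂ + (-λ_R^u)·(a - X₁). In particular a < X₁ and b > 0. -/
/-- If `δ` is positive, then `(δ + 2) / √2 < τ` forces `√2 < τ`. -/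
theorem sqrt_two_lt_of_div_lt {τ δ : ℝ} (hδ : 0 < δ) (h : (δ + 2) / Real.sqrt 2 < τ) :
    Real.sqrt 2 < τ := by
  have hr : 0 < Real.sqrt 2 := by positivity
  have h2 : Real.sqrt 2 * Real.sqrt 2 = 2 := Real.mul_self_sqrt (by norm_num)
  rw [div_lt_iff₀ hr] at h
  nlinarith

/-- If the trace `-(w + v)` and determinant `w * v` of a saddle with eigenvalues `-w`, `-v`
satisfy `-(w + v) < -((w * v + 2) / √2)`, then the unstable eigenvalue is less than `-√2`. -/
theorem sqrt_two_lt_of_trace {w v : ℝ} (hv : v < 1)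
    (h : (w * v + 2) / Real.sqrt 2 < w + v) : Real.sqrt 2 < w := by
  have hr : 0 < Real.sqrt 2 := by positivity
  have h2 : Real.sqrt 2 * Real.sqrt 2 = 2 := Real.mul_self_sqrt (by norm_num)
  have hr1 : 1 < Real.sqrt 2 := by nlinarith
  rw [div_lt_iff₀ hr] at h
  have hprod : 0 < (w - Real.sqrt 2) * (Real.sqrt 2 - v) := by nlinarith
  linarith [pos_of_mul_pos_left hprod (by linarith)]

/-- The sum and product of the roots of `x ^ 2 - τ * x + δ`, and their location when the roots
form an orientation-preserving saddle with negative eigenvalues. -/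
theorem saddle_eigenvalues {τ δ s u : ℝ} (hδ : 0 < δ) (hτ : τ < -(δ + 1))
    (hs : s = (τ + Real.sqrt (τ ^ 2 - 4 * δ)) / 2)
    (hu : u = (τ - Real.sqrt (τ ^ 2 - 4 * δ)) / 2) :
    τ = s + u ∧ δ = s * u ∧ u < -1 ∧ -1 < s ∧ s < 0 := by
  have hD : 0 ≤ τ ^ 2 - 4 * δ := by nlinarith [sq_nonneg (δ - 1)]
  have hq := Real.mul_self_sqrt hD
  have hq0 := Real.sqrt_nonneg (τ ^ 2 - 4 * δ)
  have hsum : τ = s + u := by rw [hs, hu]; ring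
  have hmul : δ = s * u := by rw [hs, hu]; linarith
  have hus : u ≤ s := by rw [hs, hu]; linarith
  have hneg : (1 + s) * (1 + u) < 0 := by linarith
  have hu1 : u < -1 := by
    by_contra! hc
    nlinarith [mul_nonneg (show 0 ≤ 1 + s by linarith) (show 0 ≤ 1 + u by linarith)]
  refine ⟨hsum, hmul, hu1, ?_, ?_⟩
  · by_contra! hc
    nlinarith [mul_nonneg (show 0 ≤ -(1 + s) by linarith) (show 0 ≤ -(1 + u) by linarith)]
  · by_contra! hc
    nlinarith

/-- `f²(T)` lies strictly to the left of the stable eigenline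
`E^s(X)`; in particular its first coordinate is less than `X₁` and its second
coordinate is positive. -/
theorem stmt13 (τL δL τR δR lamLu lamRs lamRu : ℝ)
    (hδL : 0 < δL) (hδR : 0 < δR)
    (hτL : τL > δL + 1) (hτR : τR < -(δR + 1))
    (hτL2 : τL > (δL + 2) / Real.sqrt 2) (hτR2 : τR < -((δR + 2) / Real.sqrt 2))
    (hlamLu : lamLu = (τL + Real.sqrt (τL ^ 2 - 4 * δL)) / 2)
    (hlamRs : lamRs = (τR + Real.sqrt (τR ^ 2 - 4 * δR)) / 2)
    (hlamRu : lamRu = (τR - Real.sqrt (τR ^ 2 - 4 * δR)) / 2)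
    (hφ : 0 < δR - (τR + δL + δR - (1 + τR) * lamLu) * lamLu)
    (X T : ℝ × ℝ)
    (hX : X = (1 / (δR + 1 - τR), -δR / (δR + 1 - τR)))
    (hT : T = ((1 - lamRu) * X.1, 0))
    (a b : ℝ)
    (hab : bcnf τL δL τR δR (bcnf τL δL τR δR T) = (a, b)) :
    b > X.2 + (-lamRu) * (a - X.1) ∧ a < X.1 ∧ 0 < b := by
  obtain ⟨hsum, hmul, hu1, hs1, hs0⟩ := saddle_eigenvalues hδR hτR hlamRs hlamRu
  have ht := sqrt_two_lt_of_div_lt hδL hτL2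
  have hw : Real.sqrt 2 < -lamRu := by
    refine sqrt_two_lt_of_trace (v := -lamRs) (by linarith) ?_
    have : -lamRu * -lamRs = δR := by rw [hmul]; ring
    rw [this]
    linarith
  have hr : 0 < Real.sqrt 2 := by positivity
  have h2 : Real.sqrt 2 * Real.sqrt 2 = 2 := Real.mul_self_sqrt (by norm_num)
  have hw2 : 2 < lamRu ^ 2 := by nlinarith
  have hs' : 0 < 1 - lamRs := by linarith
  have hu' : 0 < 1 - lamRu := by linarith
  have hX0 : δR + 1 - τR = (1 - lamRs) * (1 - lamRu) := by rw [hsum, hmul]; ring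
  have hT' : T = (1 / (1 - lamRs), 0) := by
    rw [hT, hX, hX0]
    ext
    · simp only
      field_simp
    · rfl
  have hfT : bcnf τL δL τR δR T =
      ((1 + lamRu) / (1 - lamRs), -δR / (1 - lamRs)) := by
    rw [hT', bcnf, if_neg (not_le.mpr (one_div_pos.mpr hs'))]
    ext
    · simp only
      rw [hsum]
      field_simp
      ring
    · simp only
      ring
  have hfneg : (1 + lamRu) / (1 - lamRs) < 0 := div_neg_of_neg_of_pos (by linarith) hs'
  rw [hfT, bcnf, if_pos hfneg.le, Prod.mk.injEq] at hab
  obtain ⟨ha, hb⟩ := hab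
  have hline : 0 < δL * (lamRu ^ 2 - 1) + -lamRu * τL * (lamRu ^ 2 - 1)
      + lamRu ^ 2 * (δR - 1) := by
    have hut : 2 < -lamRu * τL := by nlinarith
    have h1 : 0 < (-lamRu * τL - 2) * (lamRu ^ 2 - 1) := mul_pos (by linarith) (by linarith)
    have h3 : 0 < δL * (lamRu ^ 2 - 1) := mul_pos hδL (by linarith)
    have h4 : 0 < lamRu ^ 2 * δR := by positivity
    linarith
  have hleft : 0 < (τL - lamRs) * (lamRu ^ 2 - 1) + lamRu := by
    have h1 : 0 < (τL - Real.sqrt 2) * (lamRu ^ 2 - 1) := mul_pos (by linarith) (by linarith)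
    have h3 : 0 < -lamRs * (lamRu ^ 2 - 1) := mul_pos (by linarith) (by linarith)
    have h4 : 0 < (-lamRu - Real.sqrt 2) * (-lamRu * Real.sqrt 2 + 1) :=
      mul_pos (by linarith) (by nlinarith)
    nlinarith
  refine ⟨?_, ?_, ?_⟩
  · have key : b - (X.2 + -lamRu * (a - X.1)) =
        (δL * (lamRu ^ 2 - 1) + -lamRu * τL * (lamRu ^ 2 - 1) + lamRu ^ 2 * (δR - 1)) /
          ((1 - lamRs) * (1 - lamRu)) := by
      rw [← ha, ← hb, hX, hX0, hmul]
      field_simp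
      ring
    have := div_pos hline (mul_pos hs' hu')
    linarith
  · have key : X.1 - a =
        ((τL - lamRs) * (lamRu ^ 2 - 1) + lamRu) / ((1 - lamRs) * (1 - lamRu)) := by
      rw [← ha, hX, hX0, hmul]
      field_simp
      ring
    have := div_pos hleft (mul_pos hs' hu')
    linarith
  · rw [← hb]
    exact mul_pos_of_neg_of_neg (by linarith) hfneg
end

section
/- Assume the basic parameter conditions δ_L > 0, δ_R > 0, τ_L > δ_L + 1, τ_R < -(δ_R + 1), the additional conditions τ_L > (δ_L + 2)/√2 and τ_R < -(δ_R + 2)/√2, and φ > 0. Then U₂ > V₂, where U = (0, U₂) is the intersection of the line through D and f(D) with the axis x = 0, and V₂ = -λ_R^u/(λ_R^u - 1). -/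
/-- The roots of `z ^ 2 - τ * z + δ` are separated by `1`, the larger one exceeding `√2`. -/
theorem char_roots {τ δ x y : ℝ} (hδ : 0 < δ) (hτ : δ + 1 < τ) (hτ2 : (δ + 2) / √2 < τ)
    (hx : x = (τ + √(τ ^ 2 - 4 * δ)) / 2) (hy : y = (τ - √(τ ^ 2 - 4 * δ)) / 2) :
    x + y = τ ∧ x * y = δ ∧ 0 < y ∧ y < 1 ∧ √2 < x := by
  have hdisc : 0 ≤ τ ^ 2 - 4 * δ := by nlinarith [sq_nonneg (δ - 1)]
  have hsq := Real.sq_sqrt hdisc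
  have hnn := Real.sqrt_nonneg (τ ^ 2 - 4 * δ)
  have hadd : x + y = τ := by rw [hx, hy]; ring
  have hmul : x * y = δ := by rw [hx, hy]; nlinarith
  have hyx : y ≤ x := by linarith
  have hxpos : 0 < x := by linarith
  have hypos : 0 < y := pos_of_mul_pos_right (hmul ▸ hδ) hxpos.le
  have hsep : 0 < (x - 1) * (1 - y) := by nlinarith
  have hy1 : y < 1 := by
    by_contra! h
    nlinarith [mul_nonneg (sub_nonneg.2 (h.trans hyx)) (sub_nonneg.2 h)]
  have h2 : √2 ^ 2 = 2 := Real.sq_sqrt (by norm_num)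
  have h2lt : 1 < √2 := Real.one_lt_sqrt_two
  rw [div_lt_iff₀ (by positivity)] at hτ2
  have hprod : 0 < (x - √2) * (√2 - y) := by rw [← hadd, ← hmul] at hτ2; nlinarith
  have := pos_of_mul_pos_left hprod (by linarith)
  exact ⟨hadd, hmul, hypos, hy1, by linarith⟩

/-- With `a = √2`, the inequality `φ > 0` bounds the left stable eigenvalue `s` away from `1`. -/
theorem one_sub_stable_lower_bound {a u s R q : ℝ} (ha : a ^ 2 = 2) (ha1 : 1 < a) (hu : a < u)
    (hR : a < R) (hq0 : 0 < q) (hq1 : q < 1)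
    (hφ : (u - 1) * (R * q + (R + q) * u) < u ^ 2 * (1 - s)) :
    (1 - a / 2) * (R + q + a / 2 * (R * q)) < 1 - s := by
  have hR0 : 0 < R := by linarith
  have hu0 : 0 < u := by linarith
  have h1 : 0 ≤ a / 2 * u - 1 := by nlinarith
  have h2 : 0 ≤ u * (R + q - R * q + R * q * (a / 2)) + R * q := by
    have h3 : 0 < R + q - R * q := by nlinarith
    positivity
  have h4 := mul_nonneg h1 h2
  have h5 : (a / 2 * u - 1) * (u * (R + q - R * q + R * q * (a / 2)) + R * q)
      = (u - 1) * (R * q + (R + q) * u)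
        - u ^ 2 * ((1 - a / 2) * (R + q + a / 2 * (R * q))) := by
    ring
  exact lt_of_mul_lt_mul_left (by linarith) (sq_nonneg u)

theorem mul_add_one_lt_of_sqrt_two_lt {a R q : ℝ} (ha : a ^ 2 = 2) (ha1 : 1 < a)
    (hR : a < R) (hq0 : 0 < q) :
    q * (R + 1) < (1 - a / 2) * (R + q + a / 2 * (R * q)) * (R + q) := by
  have ha2 : a < 3 / 2 := by nlinarith
  obtain ⟨e, rfl⟩ : ∃ e, R = a + e := ⟨R - a, by ring⟩
  have he : 0 < e := by linarith
  have key : (1 - a / 2) * (a + e + q + a / 2 * ((a + e) * q)) * (a + e + q) - q * (a + e + 1)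
      = (2 - a) * (1 - q) ^ 2
        + e * ((2 * a - 2) + (3 - 2 * a) * q + (a - 1) / 2 * q ^ 2)
        + e ^ 2 * ((1 - a / 2) * (1 + a / 2 * q)) := by
    linear_combination ((1 - a / 2) * (a + e + q) * q / 2 + (1 - a / 2) * (1 + e * q / 2)
      - (2 * e + 3 * q + (e + q) * e * q / 2) / 2 + e ^ 2 * q / 4) * ha
  have h1 : 0 ≤ (2 - a) * (1 - q) ^ 2 := mul_nonneg (by linarith) (sq_nonneg _)
  have h2 : 0 < (2 * a - 2) + (3 - 2 * a) * q + (a - 1) / 2 * q ^ 2 := by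
    have : 0 < a - 1 := by linarith
    have : 0 < 3 - 2 * a := by linarith
    have : 0 < 2 * a - 2 := by linarith
    positivity
  have h3 : 0 < (1 - a / 2) * (1 + a / 2 * q) :=
    mul_pos (by linarith) (by nlinarith)
  have h4 := mul_pos he h2
  have h5 := mul_pos (pow_pos he 2) h3
  linarith

/-- the intersection `U = (0, U₂)` of the line through `D` and
`f(D)` with the axis `x = 0` satisfies `U₂ > V₂ = -λ_R^u/(λ_R^u - 1)`. -/
theorem stmt15 (τL δL τR δR lamLs lamLu lamRu : ℝ)
    (hδL : 0 < δL) (hδR : 0 < δR)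
    (hτL : τL > δL + 1) (hτR : τR < -(δR + 1))
    (hτL2 : τL > (δL + 2) / Real.sqrt 2) (hτR2 : τR < -((δR + 2) / Real.sqrt 2))
    (hlamLs : lamLs = (τL - Real.sqrt (τL ^ 2 - 4 * δL)) / 2)
    (hlamLu : lamLu = (τL + Real.sqrt (τL ^ 2 - 4 * δL)) / 2)
    (hlamRu : lamRu = (τR - Real.sqrt (τR ^ 2 - 4 * δR)) / 2)
    (hφ : 0 < δR - (τR + δL + δR - (1 + τR) * lamLu) * lamLu)
    (D : ℝ × ℝ) (hD : D = (1 / (1 - lamLs), 0)) :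
    ∀ U₂ t : ℝ,
      ((0 : ℝ), U₂) = D + t • (bcnf τL δL τR δR D - D) →
      U₂ > -lamRu / (lamRu - 1) := by
  intro U₂ t h
  obtain ⟨hadd, hmul, hs0, hs1, hu⟩ := char_roots hδL hτL hτL2 hlamLu hlamLs
  obtain ⟨hadd', hmul', hq0, hq1, hR⟩ :=
    char_roots (τ := -τR) (x := -lamRu) (y := lamRu - τR) hδR (by linarith) (by linarith)
      (by rw [hlamRu, neg_sq]; ring) (by rw [hlamRu, neg_sq]; ring)
  have ha : √2 ^ 2 = (2 : ℝ) := Real.sq_sqrt (by norm_num)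
  have ha1 : 1 < √2 := Real.one_lt_sqrt_two
  generalize √2 = a at *
  obtain ⟨R, rfl⟩ : ∃ R, lamRu = -R := ⟨-lamRu, by ring⟩
  obtain ⟨q, rfl⟩ : ∃ q, τR = -R - q := ⟨-R - τR, by ring⟩
  rw [neg_neg] at hmul' hR
  rw [show -R - (-R - q) = q by ring] at hmul' hq0 hq1
  subst hmul' hmul
  have hφ' : (lamLu - 1) * (R * q + (R + q) * lamLu) < lamLu ^ 2 * (1 - lamLs) := by
    linarith
  have hv := one_sub_stable_lower_bound ha ha1 hu hR hq0 hq1 hφ'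
  have hR0 : 0 < R := by linarith
  have hkey : q * (R + 1) < (1 - lamLs) * (lamLs + R + q) := by
    have := mul_lt_mul_of_pos_right hv (add_pos hR0 hq0)
    have := mul_add_one_lt_of_sqrt_two_lt ha ha1 hR hq0
    nlinarith [mul_pos hs0 (sub_pos.2 hs1)]
  have hs1' : 0 < 1 - lamLs := by linarith
  have hD0 : ¬ D.1 ≤ 0 := by rw [hD]; simpa using hs1
  rw [bcnf, if_neg hD0, hD] at h
  simp only [Prod.ext_iff, Prod.fst_add, Prod.snd_add, Prod.smul_fst, Prod.smul_snd,
    Prod.fst_sub, Prod.snd_sub, smul_eq_mul] at h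
  obtain ⟨hfst, hsnd⟩ := h
  have ht : t * (lamLs + R + q) = 1 := by
    field_simp at hfst
    linarith
  have hU : U₂ = -(R * q) / ((1 - lamLs) * (lamLs + R + q)) := by
    have hS : 0 < lamLs + R + q := by positivity
    rw [hsnd, eq_one_div_of_mul_eq_one_left ht]
    field_simp
    ring
  have hV : -(-R) / (-R - 1) = -(R * q) / (q * (R + 1)) := by
    have : -R - 1 ≠ 0 := by linarith
    field_simp
    ring
  rw [hU, hV, gt_iff_lt, neg_div, neg_div, neg_lt_neg_iff]
  gcongr
end

section
/- Assume the basic parameter conditions δ_L > 0, δ_R > 0, τ_L > δ_L + 1, τ_R < -(δ_R + 1), the additional conditions τ_L > (δ_L + 2)/√2 and τ_R < -(δ_R + 2)/√2, and φ > 0. Then f is topologically transitive on the closure of W^u(X): for any open sets M, N ⊆ ℝ² each having nonempty intersection with cl(W^u(X)), there exists n ≥ 0 such that f^n(M) ∩ N ≠ ∅. -/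
/-- The parameter conditions, in terms of the eigenvalues `s < 1 < u` of the left matrix and
`-b < -1 < -a` of the right matrix. -/
structure SaddleParams (a b s u : ℝ) : Prop where
  a_pos : 0 < a
  a_lt : a < 1
  b_gt : Real.sqrt 2 < b
  s_pos : 0 < s
  s_lt : s < 1
  u_gt : Real.sqrt 2 < u
  phi_pos : 0 < a * b - (-(a + b) + u * s + a * b - (1 - (a + b)) * u) * u

/-- The normal form written in terms of the eigenvalues of its two matrices. -/
noncomputable def eigMap (a b s u : ℝ) : ℝ × ℝ → ℝ × ℝ :=
  bcnf (u + s) (u * s) (-(a + b)) (a * b)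

/-- A polygon bounded by the stable and unstable lines of the left fixed point and by the line
through the two points `D`, `f(D)`, where `D = (1 / (1 - s), 0)`. -/
def trapRegion (a b s u : ℝ) : Set (ℝ × ℝ) :=
  {p | (1 - s) * (p.2 + s * p.1) ≤ s ∧ -u ≤ (u - 1) * (p.2 + u * p.1) ∧
    a * b * ((1 - s) * p.1 - 1) ≤ (1 - s) * (a + b + s) * p.2}

/-- A linear function vanishing on the stable line of the right fixed point. -/
noncomputable def stableFun (b : ℝ) (p : ℝ × ℝ) : ℝ := p.2 - b * p.1 + b / (1 + b)

/-- The point with coordinates `c`, `t` along the stable and unstable directions at the right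
fixed point. -/
noncomputable def eigPoint (a b c t : ℝ) : ℝ × ℝ :=
  (1 / ((1 + a) * (1 + b)) + c + t, -(a * b) / ((1 + a) * (1 + b)) + b * c + a * t)

namespace SaddleParams

variable {a b s u : ℝ}

lemma one_lt_b (h : SaddleParams a b s u) : 1 < b :=
  lt_trans (by rw [Real.lt_sqrt] <;> norm_num) h.b_gt

lemma one_lt_u (h : SaddleParams a b s u) : 1 < u :=
  lt_trans (by rw [Real.lt_sqrt] <;> norm_num) h.u_gt

lemma phi_bound (h : SaddleParams a b s u) :
    u * (u - 1) * (a + b + s - 1) + a * b * (u - 1) < u * (1 - s) := by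
  have := h.phi_pos
  nlinarith

lemma a_add_s_lt_one (h : SaddleParams a b s u) : a + s < 1 := by
  have hr : Real.sqrt 2 ^ 2 = 2 := Real.sq_sqrt (by norm_num)
  have hr1 : 1 < Real.sqrt 2 := by rw [Real.lt_sqrt] <;> norm_num
  have hb := h.b_gt
  have hu := h.u_gt
  have hφ := h.phi_bound
  have ha := h.a_pos
  have hs := h.s_pos
  set r := Real.sqrt 2
  have hu0 : 0 < u := by linarith
  have h1 : u * (r - 1) * (a + r + s - 1) ≤ u * (u - 1) * (a + b + s - 1) := by
    have : 0 ≤ u * (u - 1) := mul_nonneg hu0.le (by linarith)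
    have : 0 ≤ a + r + s - 1 := by linarith
    gcongr
  have h2 : a * (u * (r - 1)) ≤ a * b * (u - 1) := by
    rw [mul_assoc]
    refine mul_le_mul_of_nonneg_left ?_ ha.le
    nlinarith [mul_pos (show 0 < b - r by linarith) (show 0 < u - 1 by linarith)]
  have h3 : u * ((r - 1) * (a + r + s - 1) + a * (r - 1)) < u * (1 - s) := by nlinarith
  have h4 := lt_of_mul_lt_mul_left h3 hu0.le
  by_contra! hc
  nlinarith [mul_pos (show 0 < r - 1 by linarith) hs]

lemma bottom_bound (h : SaddleParams a b s u) :
    a * (1 + b) < (1 - s) * (a + b + s) := by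
  have h1 := h.a_add_s_lt_one
  have h2 := h.one_lt_b
  nlinarith [mul_pos (show 0 < 1 - a - s by linarith) (show 0 < b + s by linarith [h.s_pos])]

lemma stableFun_pos_of_nonpos (h : SaddleParams a b s u) {p : ℝ × ℝ}
    (hp : p ∈ trapRegion a b s u) (hx : p.1 ≤ 0) : 0 < stableFun b p := by
  obtain ⟨-, -, h3⟩ := hp
  have hb := h.one_lt_b
  have hK := h.bottom_bound
  have ha := h.a_pos
  have hs := h.s_lt
  have hs' := h.s_pos
  have ha1 := h.a_lt
  unfold stableFun
  have hb1 : 0 < 1 + b := by linarith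
  have hE : 0 < (1 - s) * (a + b + s) := by nlinarith
  have key : 0 < (1 - s) * (a + b + s) * (p.2 - b * p.1 + b / (1 + b)) := by
    have e : a * b < (1 - s) * (a + b + s) * (b / (1 + b)) := by
      rw [← mul_div_assoc, lt_div_iff₀ hb1]
      nlinarith
    have e2 : 0 ≤ (1 - s) * (b * (b + s)) * (-p.1) := by
      apply mul_nonneg
      · apply mul_nonneg <;> nlinarith
      · linarith
    nlinarith
  exact pos_of_mul_pos_right key hE.le

lemma fst_pos_of_stableFun_eq_zero (h : SaddleParams a b s u) {p : ℝ × ℝ}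
    (hp : p ∈ trapRegion a b s u) (h0 : stableFun b p = 0) : 0 < p.1 := by
  by_contra! hx
  exact (h.stableFun_pos_of_nonpos hp hx).ne' h0

lemma fst_bounds (h : SaddleParams a b s u) {p : ℝ × ℝ} (hp : p ∈ trapRegion a b s u) :
    -(u / ((u - 1) * (u - s)) + s / ((1 - s) * (u - s))) ≤ p.1 ∧ (1 - s) * p.1 ≤ 1 := by
  obtain ⟨h1, h2, h3⟩ := hp
  have hb := h.one_lt_b
  have hu := h.one_lt_u
  have ha := h.a_pos
  have hs := h.s_lt
  have hs' := h.s_pos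
  have hu1 : 0 < u - 1 := by linarith
  have hs1 : 0 < 1 - s := by linarith
  have hus : 0 < u - s := by linarith
  constructor
  · have e1 : p.2 + s * p.1 ≤ s / (1 - s) := by rw [le_div_iff₀ hs1]; linarith
    have e2 : -(u / (u - 1)) ≤ p.2 + u * p.1 := by
      rw [← neg_div, div_le_iff₀ hu1]; linarith
    have e3 : -(u / (u - 1) + s / (1 - s)) ≤ (u - s) * p.1 := by linarith
    have e4 : u / ((u - 1) * (u - s)) + s / ((1 - s) * (u - s))
        = (u / (u - 1) + s / (1 - s)) / (u - s) := by
      field_simp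
    rw [e4, ← neg_div, div_le_iff₀ hus]
    linarith
  · have e : (a * b + s * (a + b + s)) * ((1 - s) * p.1 - 1) ≤ 0 := by
      nlinarith [mul_le_mul_of_nonneg_left h1 (show 0 ≤ a + b + s by linarith)]
    have e' : 0 < a * b + s * (a + b + s) := by positivity
    have := nonpos_of_mul_nonpos_right e e'
    linarith

lemma mapsTo_trapRegion (h : SaddleParams a b s u) :
    Set.MapsTo (eigMap a b s u) (trapRegion a b s u) (trapRegion a b s u) := by
  intro p hp
  obtain ⟨-, hd⟩ := h.fst_bounds hp
  obtain ⟨h1, h2, h3⟩ := hp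
  obtain ⟨x, y⟩ := p
  have hb := h.one_lt_b
  have hu := h.one_lt_u
  have ha := h.a_pos
  have ha1 := h.a_lt
  have hs := h.s_lt
  have hs' := h.s_pos
  have hφ := h.phi_bound
  simp only at h1 h2 h3 hd
  have hu1 : 0 < u - 1 := by linarith
  have hs1 : 0 < 1 - s := by linarith
  have hE : 0 < a + b + s := by linarith
  unfold eigMap bcnf
  split_ifs with hx
  · simp only at hx
    have k1 : (1 - s) * (-(u * s) * x + s * ((u + s) * x + y + 1)) ≤ s := by nlinarith
    have hy' : 0 ≤ -(u * s) * x := by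
      have : 0 < u * s := by nlinarith
      nlinarith
    refine ⟨k1, ?_, ?_⟩
    · simp only
      nlinarith
    · simp only
      have k2 : s * ((1 - s) * ((u + s) * x + y + 1) - 1) ≤ 0 := by nlinarith
      have k3 := nonpos_of_mul_nonpos_right k2 hs'
      have k4 : 0 ≤ (1 - s) * (a + b + s) * (-(u * s) * x) := by positivity
      have k5 : a * b * ((1 - s) * ((u + s) * x + y + 1) - 1) ≤ 0 :=
        mul_nonpos_of_nonneg_of_nonpos (by positivity) k3
      linarith
  · simp only [not_le] at hx
    have hab : 0 < a * b := by positivity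
    have k0 : (1 - s) * (-(a + b) * x + y + 1) ≤ 1 - (1 - s) * (a + b + s) * x := by nlinarith
    refine ⟨?_, ?_, ?_⟩
    · simp only
      have : 0 ≤ (1 - s) * (a * b) * x := by positivity
      have : 0 ≤ (1 - s) * (a + b + s) * x := by positivity
      nlinarith
    · simp only
      have c1 : 0 < (1 - s) * (a + b + s) := by positivity
      refine le_of_mul_le_mul_left ?_ c1
      have c2 : 0 ≤ u * (a + b + s) * (a + b) + a * b * (a + b + s) - u * (a * b) := by
        have e : u * (a + b + s) * (a + b) + a * b * (a + b + s) - u * (a * b)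
            = u * (a ^ 2 + a * b + b ^ 2 + s * (a + b)) + a * b * (a + b + s) := by ring
        rw [e]
        positivity
      have c3 : 0 ≤ (u - 1) * (u * (a + b + s) * (a + b) + a * b * (a + b + s) - u * (a * b))
          * (1 - (1 - s) * x) := by
        apply mul_nonneg (mul_nonneg hu1.le c2); linarith
      have c4 := mul_le_mul_of_nonneg_left h3 (show 0 ≤ (u - 1) * u by nlinarith)
      have c5 := mul_le_mul_of_nonneg_left hφ.le hE.le
      linear_combination c3 + c4 + c5
    · simp only
      linear_combination a * b * k0

end SaddleParams

/-- `A` contains a segment of horizontal extent `l` with right endpoint `p` and slope in the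
invariant cone. -/
def ConeSegmentTo (a s : ℝ) (A : Set (ℝ × ℝ)) (p : ℝ × ℝ) (l : ℝ) : Prop :=
  ∃ m : ℝ, -s ≤ m ∧ m ≤ a ∧ ∀ t, 0 ≤ t → t ≤ l → (p.1 - t, p.2 - m * t) ∈ A

lemma ConeSegmentTo.mono {a s : ℝ} {A : Set (ℝ × ℝ)} {p : ℝ × ℝ} {l l' : ℝ}
    (h : ConeSegmentTo a s A p l) (hl : l' ≤ l) : ConeSegmentTo a s A p l' := by
  obtain ⟨m, h1, h2, h3⟩ := h
  exact ⟨m, h1, h2, fun t ht ht' => h3 t ht (ht'.trans hl)⟩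

lemma eigMap_of_nonpos (a b s u : ℝ) {x : ℝ} (y : ℝ) (hx : x ≤ 0) :
    eigMap a b s u (x, y) = ((u + s) * x + y + 1, -(u * s) * x) := by
  simp [eigMap, bcnf, hx]

lemma eigMap_of_nonneg (a b s u : ℝ) {x : ℝ} (y : ℝ) (hx : 0 ≤ x) :
    eigMap a b s u (x, y) = (-(a + b) * x + y + 1, -(a * b) * x) := by
  rcases hx.eq_or_lt with rfl | hx
  · simp [eigMap, bcnf]
  · simp [eigMap, bcnf, hx.not_ge]

lemma continuous_eigMap (a b s u : ℝ) : Continuous (eigMap a b s u) := by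
  unfold eigMap bcnf
  refine Continuous.if_le (by fun_prop) (by fun_prop) (by fun_prop) (by fun_prop) ?_
  intro p hp
  simp [hp]

lemma exists_continuous_rightInverse_eigMap {a b s u : ℝ} (hab : 0 < a * b) (hus : 0 < u * s) :
    ∃ g : ℝ × ℝ → ℝ × ℝ, Continuous g ∧ Function.RightInverse g (eigMap a b s u) := by
  refine ⟨fun p => if 0 ≤ p.2 then (-p.2 / (u * s), p.1 - 1 + (u + s) * (p.2 / (u * s)))
    else (-p.2 / (a * b), p.1 - 1 - (a + b) * (p.2 / (a * b))), ?_, ?_⟩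
  · refine Continuous.if_le (by fun_prop) (by fun_prop) (by fun_prop) (by fun_prop) ?_
    intro p hp
    simp [← hp]
  · rintro ⟨x, y⟩
    simp only
    split_ifs with hy
    · rw [eigMap_of_nonpos _ _ _ _ _ (div_nonpos_of_nonpos_of_nonneg (by linarith) hus.le)]
      ext
      · simp only; ring
      · simp only; rw [neg_mul, mul_div_cancel₀ _ hus.ne']; ring
    · rw [eigMap_of_nonneg _ _ _ _ _ (div_nonneg (by linarith) hab.le)]
      ext
      · simp only; ring
      · simp only; rw [neg_mul, mul_div_cancel₀ _ hab.ne']; ring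

namespace SaddleParams

variable {a b s u : ℝ}

lemma image_coneSegment_left (h : SaddleParams a b s u) {A : Set (ℝ × ℝ)} {p : ℝ × ℝ} {l : ℝ}
    (hA : ConeSegmentTo a s A p l) (hp : p.1 ≤ 0) :
    ConeSegmentTo a s (eigMap a b s u '' A) (eigMap a b s u p) (u * l) := by
  obtain ⟨m, h1, h2, h3⟩ := hA
  have hu := h.one_lt_u
  have ha := h.a_pos
  have hs := h.s_pos
  have hκ : 0 < u + s + m := by linarith
  refine ⟨-(u * s) / (u + s + m), ?_, ?_, fun t ht htl => ?_⟩
  · rw [le_div_iff₀ hκ]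
    nlinarith
  · rw [div_le_iff₀ hκ]
    have : 0 < u * s := by positivity
    nlinarith
  · have hτ : 0 ≤ t / (u + s + m) := by positivity
    have hτl : t / (u + s + m) ≤ l := by
      rw [div_le_iff₀ hκ]
      have hl : 0 ≤ l := by
        by_contra! hl
        nlinarith
      nlinarith
    refine ⟨_, h3 _ hτ hτl, ?_⟩
    obtain ⟨x, y⟩ := p
    rw [eigMap_of_nonpos _ _ _ _ _ (by simp only at hp ⊢; linarith),
      eigMap_of_nonpos _ _ _ _ _ hp]
    ext
    · simp only
      field_simp
      ring
    · simp only
      ring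

lemma image_coneSegment_right (h : SaddleParams a b s u) {A : Set (ℝ × ℝ)} {q : ℝ × ℝ} {l m : ℝ}
    (h2 : m ≤ a)
    (h3 : ∀ t, 0 ≤ t → t ≤ l → (q.1 + t, q.2 + m * t) ∈ A) (hq : 0 ≤ q.1) :
    ConeSegmentTo a s (eigMap a b s u '' A) (eigMap a b s u q) (b * l) := by
  have hb := h.one_lt_b
  have ha := h.a_pos
  have hs := h.s_pos
  have hκ : 0 < a + b - m := by linarith
  refine ⟨(a * b) / (a + b - m), ?_, ?_, fun t ht htl => ?_⟩
  · have : 0 ≤ (a * b) / (a + b - m) := by positivity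
    linarith
  · rw [div_le_iff₀ hκ]
    nlinarith
  · have hτ : 0 ≤ t / (a + b - m) := by positivity
    have hτl : t / (a + b - m) ≤ l := by
      rw [div_le_iff₀ hκ]
      have hl : 0 ≤ l := by
        by_contra! hl
        nlinarith
      nlinarith
    refine ⟨_, h3 _ hτ hτl, ?_⟩
    obtain ⟨x, y⟩ := q
    rw [eigMap_of_nonneg _ _ _ _ _ (by simp only at hq ⊢; linarith),
      eigMap_of_nonneg _ _ _ _ _ hq]
    ext
    · simp only
      field_simp
      ring
    · simp only
      ring

lemma image_coneSegment_right' (h : SaddleParams a b s u) {A : Set (ℝ × ℝ)} {p : ℝ × ℝ} {l : ℝ}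
    (hA : ConeSegmentTo a s A p l) (hp : l ≤ p.1) :
    ∃ q, ConeSegmentTo a s (eigMap a b s u '' A) q (b * l) := by
  obtain ⟨m, -, h2, h3⟩ := hA
  refine ⟨_, h.image_coneSegment_right (q := (p.1 - l, p.2 - m * l)) h2
    (fun t ht htl => ?_) (by simp only; linarith)⟩
  convert h3 (l - t) (by linarith) (by linarith) using 2
  · ring
  · simp only
    ring

lemma stable_or_growth_of_fold (h : SaddleParams a b s u) {A : Set (ℝ × ℝ)}
    (hA : A ⊆ trapRegion a b s u) {y l : ℝ} (hy : 0 < y + b / (1 + b))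
    (hseg : ConeSegmentTo a s A (y + 1, 0) l) :
    (∃ p ∈ A, stableFun b p = 0) ∨ ∃ q, ConeSegmentTo a s (eigMap a b s u '' A) q (b * l) := by
  rcases le_or_gt l (y + 1) with hl | hl
  · exact Or.inr (h.image_coneSegment_right' hseg hl)
  · left
    obtain ⟨m, h1, h2, h3⟩ := hseg
    have hb := h.one_lt_b
    have hb1 : b / (1 + b) = 1 - 1 / (1 + b) := by field_simp; ring
    have hb2 : 0 < 1 / (1 + b) := by positivity
    have hy1 : 0 < y + 1 := by linarith
    have hend := h3 (y + 1) hy1.le hl.le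
    have hpos := h.stableFun_pos_of_nonpos (hA hend) (by simp)
    have hneg : stableFun b (y + 1 - 0, 0 - m * 0) < 0 := by
      have e : stableFun b (y + 1 - 0, 0 - m * 0) = -(b * (y + b / (1 + b))) := by
        unfold stableFun
        field_simp
        ring
      rw [e]
      have : 0 < b * (y + b / (1 + b)) := by positivity
      linarith
    have hc : ContinuousOn (fun t => stableFun b (y + 1 - t, 0 - m * t)) (Set.Icc 0 (y + 1)) := by
      unfold stableFun
      fun_prop
    obtain ⟨t, ht, ht0⟩ := intermediate_value_Icc hy1.le hc ⟨hneg.le, hpos.le⟩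
    exact ⟨_, h3 t ht.1 (ht.2.trans hl.le), ht0⟩

lemma stable_or_growth (h : SaddleParams a b s u) {A : Set (ℝ × ℝ)}
    (hA : A ⊆ trapRegion a b s u) {p : ℝ × ℝ} {l r : ℝ} (hl : 0 ≤ l)
    (hrb : r ≤ b) (hru : r ≤ u) (hrbb : 2 * r ≤ b * b) (hrbu : 2 * r ≤ b * u)
    (hseg : ConeSegmentTo a s A p l) :
    (∃ p ∈ eigMap a b s u '' A, stableFun b p = 0) ∨
      (∃ q, ConeSegmentTo a s (eigMap a b s u '' A) q (r * l)) ∨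
      ∃ q, ConeSegmentTo a s (eigMap a b s u '' (eigMap a b s u '' A)) q (r * l) := by
  have hA' : eigMap a b s u '' A ⊆ trapRegion a b s u :=
    (h.mapsTo_trapRegion.mono_left hA).image_subset
  rcases le_or_gt p.1 0 with hp | hp
  · exact Or.inr (Or.inl ⟨_, (h.image_coneSegment_left hseg hp).mono (by gcongr)⟩)
  rcases le_or_gt l p.1 with hp' | hp'
  · obtain ⟨q, hq⟩ := h.image_coneSegment_right' hseg hp'
    exact Or.inr (Or.inl ⟨q, hq.mono (by gcongr)⟩)
  obtain ⟨m, h1, h2, h3⟩ := hseg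
  have h0 : ((0 : ℝ), p.2 - m * p.1) ∈ A := by
    simpa using h3 p.1 hp.le hp'.le
  set y := p.2 - m * p.1 with hy
  have hpos : 0 < y + b / (1 + b) := by
    have := h.stableFun_pos_of_nonpos (hA h0) le_rfl
    simpa [stableFun] using this
  have himg : eigMap a b s u (0, y) = (y + 1, 0) := by
    rw [eigMap_of_nonneg _ _ _ _ _ le_rfl]
    simp
  have key : ∃ c, 2 * r ≤ b * c ∧
      ConeSegmentTo a s (eigMap a b s u '' A) (y + 1, 0) (c * (l / 2)) := by
    rcases le_total (l / 2) p.1 with hh | hh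
    · refine ⟨b, hrbb, ?_⟩
      rw [← himg]
      refine h.image_coneSegment_right h2 (fun t ht htl => ?_) le_rfl
      convert h3 (p.1 - t) (by linarith) (by linarith) using 2
      · ring
      · rw [hy]; ring
    · refine ⟨u, hrbu, ?_⟩
      rw [← himg]
      refine h.image_coneSegment_left ⟨m, h1, h2, fun t ht htl => ?_⟩ le_rfl
      convert h3 (p.1 + t) (by linarith) (by linarith) using 2
      · ring
      · simp only
        rw [hy]; ring
  obtain ⟨c, hc, hseg⟩ := key
  rcases h.stable_or_growth_of_fold hA' hpos hseg with hs | ⟨q, hq⟩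
  · exact Or.inl hs
  · refine Or.inr (Or.inr ⟨q, hq.mono ?_⟩)
    nlinarith

/-- A set in the trapping region containing a cone segment is eventually mapped across the stable
line of the right fixed point. -/
lemma exists_iterate_stable (h : SaddleParams a b s u) {A : Set (ℝ × ℝ)}
    (hA : A ⊆ trapRegion a b s u) {p : ℝ × ℝ} {l : ℝ} (hl : 0 < l)
    (hseg : ConeSegmentTo a s A p l) :
    ∃ n : ℕ, ∃ q ∈ A, stableFun b ((eigMap a b s u)^[n] q) = 0 := by
  by_contra! hcon
  have hb := h.one_lt_b
  have hu := h.one_lt_u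
  have hb2 := h.b_gt
  have hu2 := h.u_gt
  have hsq : Real.sqrt 2 * Real.sqrt 2 = 2 := Real.mul_self_sqrt (by norm_num)
  have hs0 : 0 ≤ Real.sqrt 2 := Real.sqrt_nonneg 2
  obtain ⟨r, hr1, hr⟩ : ∃ r, 1 < r ∧ r < min (min b u) (min (b * b / 2) (b * u / 2)) := by
    refine exists_between ?_
    simp only [lt_min_iff]
    refine ⟨⟨hb, hu⟩, ?_, ?_⟩
    · nlinarith
    · nlinarith
  simp only [lt_min_iff] at hr
  obtain ⟨⟨hr2, hr3⟩, hr4, hr5⟩ := hr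
  have hAn : ∀ n : ℕ, (eigMap a b s u)^[n] '' A ⊆ trapRegion a b s u := fun n =>
    ((h.mapsTo_trapRegion.iterate n).mono_left hA).image_subset
  have hsucc : ∀ n : ℕ, eigMap a b s u '' ((eigMap a b s u)^[n] '' A)
      = (eigMap a b s u)^[n + 1] '' A := fun n => by
    rw [Function.iterate_succ', Set.image_comp]
  have grow : ∀ k : ℕ, ∃ n : ℕ, ∃ q, ConeSegmentTo a s ((eigMap a b s u)^[n] '' A) q (r ^ k * l) := by
    intro k
    induction k with
    | zero => exact ⟨0, p, by simpa using hseg⟩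
    | succ k ih =>
      obtain ⟨n, q, hq⟩ := ih
      have := h.stable_or_growth (hAn n) (by positivity) hr2.le hr3.le (by linarith) (by linarith) hq
      rw [hsucc, hsucc] at this
      have e : r ^ (k + 1) * l = r * (r ^ k * l) := by ring
      rw [e]
      rcases this with ⟨_, ⟨x, hx, rfl⟩, hx0⟩ | hq | hq
      · exact absurd hx0 (hcon _ x hx)
      · exact ⟨_, hq⟩
      · exact ⟨_, hq⟩
  set B := u / ((u - 1) * (u - s)) + s / ((1 - s) * (u - s))
  obtain ⟨k, hk⟩ := pow_unbounded_of_one_lt ((1 / (1 - s) + B) / l) hr1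
  obtain ⟨n, q, m, -, -, hm⟩ := grow k
  have hlk : 0 ≤ r ^ k * l := by positivity
  have e1 := (h.fst_bounds (hAn n (hm 0 le_rfl hlk))).2
  have e2 := (h.fst_bounds (hAn n (hm _ hlk le_rfl))).1
  rw [div_lt_iff₀ hl] at hk
  simp only [sub_zero] at e1 e2
  rw [← le_div_iff₀' (by linarith [h.s_lt])] at e1
  linarith

end SaddleParams

open Filter Topology in
lemma tendsto_pow_mul_zero {r : ℝ} (hr : |r| < 1) (c : ℝ) :
    Tendsto (fun n : ℕ => r ^ n * c) atTop (𝓝 0) := by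
  simpa using (tendsto_pow_atTop_nhds_zero_of_abs_lt_one hr).mul_const c

namespace SaddleParams

open Filter Topology

variable {a b s u : ℝ}

lemma eigMap_eigPoint (h : SaddleParams a b s u) {c t : ℝ}
    (hc : 0 ≤ 1 / ((1 + a) * (1 + b)) + c + t) :
    eigMap a b s u (eigPoint a b c t) = eigPoint a b (-a * c) (-b * t) := by
  have ha := h.a_pos
  have hb := h.one_lt_b
  unfold eigPoint
  rw [eigMap_of_nonneg _ _ _ _ _ hc]
  ext
  · simp only
    field_simp
    ring
  · simp only
    field_simp
    ring

lemma iterate_eigPoint (h : SaddleParams a b s u) {c t : ℝ} (k : ℕ)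
    (hc : ∀ j < k, 0 ≤ 1 / ((1 + a) * (1 + b)) + (-a) ^ j * c + (-b) ^ j * t) :
    (eigMap a b s u)^[k] (eigPoint a b c t) = eigPoint a b ((-a) ^ k * c) ((-b) ^ k * t) := by
  induction k with
  | zero => simp
  | succ k ih =>
    rw [Function.iterate_succ_apply', ih fun j hj => hc j (by omega),
      h.eigMap_eigPoint (hc k (by omega))]
    congr 1 <;> ring

lemma exists_eq_eigPoint (h : SaddleParams a b s u) (p : ℝ × ℝ) :
    ∃ c t, p = eigPoint a b c t := by
  have hab : b - a ≠ 0 := by linarith [h.a_lt, h.one_lt_b]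
  have ha := h.a_pos
  have hb := h.one_lt_b
  obtain ⟨x, y⟩ := p
  refine ⟨((y - -(a * b) / ((1 + a) * (1 + b))) - a * (x - 1 / ((1 + a) * (1 + b)))) / (b - a),
    (b * (x - 1 / ((1 + a) * (1 + b))) - (y - -(a * b) / ((1 + a) * (1 + b)))) / (b - a), ?_⟩
  unfold eigPoint
  ext
  · simp only
    field_simp
    ring
  · simp only
    field_simp
    ring

lemma stableFun_eigPoint (h : SaddleParams a b s u) (c t : ℝ) :
    stableFun b (eigPoint a b c t) = (a - b) * t := by
  have ha := h.a_pos
  have hb := h.one_lt_b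
  unfold stableFun eigPoint
  simp only
  field_simp
  ring

lemma continuous_eigPoint (a b : ℝ) : Continuous fun q : ℝ × ℝ => eigPoint a b q.1 q.2 := by
  unfold eigPoint
  fun_prop

lemma trapRegion_mem_nhds (h : SaddleParams a b s u) :
    trapRegion a b s u ∈ 𝓝 (eigPoint a b 0 0) := by
  have hb := h.one_lt_b
  have hu := h.one_lt_u
  have ha := h.a_pos
  have ha1 := h.a_lt
  have hs := h.s_lt
  have hs' := h.s_pos
  have hD : 0 < (1 + a) * (1 + b) := by positivity
  have hopen : IsOpen {p : ℝ × ℝ | (1 - s) * (p.2 + s * p.1) < s ∧ -u < (u - 1) * (p.2 + u * p.1) ∧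
      a * b * ((1 - s) * p.1 - 1) < (1 - s) * (a + b + s) * p.2} := by
    simp only [Set.ofPred_and]
    refine IsOpen.inter ?_ (IsOpen.inter ?_ ?_) <;> exact isOpen_lt (by fun_prop) (by fun_prop)
  refine mem_of_superset (hopen.mem_nhds ?_) fun p hp => ⟨hp.1.le, hp.2.1.le, hp.2.2.le⟩
  set w := 1 / ((1 + a) * (1 + b)) with hw
  have hw0 : 0 < w := by positivity
  have hw1 : w * ((1 + a) * (1 + b)) = 1 := by rw [hw]; field_simp
  have e : eigPoint a b 0 0 = (w, -(a * b) * w) := by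
    unfold eigPoint
    ext
    · simp [hw]
    · simp only [hw]
      ring
  have hab : 0 < a * b := by positivity
  have hwlt : w < 1 := by nlinarith
  rw [e]
  refine ⟨?_, ?_, ?_⟩
  · simp only
    have h1 : 0 < (1 - s) * (a * b * w) := mul_pos (by linarith) (by positivity)
    have h2 : (1 - s) * w < 1 := by nlinarith
    nlinarith
  · simp only
    have h1 : a * b * w < 1 := by nlinarith
    have h2 : 0 < (u - 1) * (u * w) := mul_pos (by linarith) (by positivity)
    nlinarith
  · simp only
    have h1 : w * ((1 - s) * (1 + a + b + s)) < 1 := by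
      rw [← hw1]
      refine mul_lt_mul_of_pos_left ?_ hw0
      nlinarith [mul_pos hs' ha]
    nlinarith

/-- A point near the right fixed point whose backward orbit converges to it without leaving a
neighbourhood lies on the unstable line. -/
lemma eventually_unstable (h : SaddleParams a b s u) {z : ℕ → ℝ × ℝ}
    (hz : ∀ n, eigMap a b s u (z (n + 1)) = z n)
    (hlim : Tendsto z atTop (𝓝 (eigPoint a b 0 0))) {d : ℝ} (hd : 0 < d) :
    ∀ᶠ n in atTop, ∃ t, |t| < d ∧ z n = eigPoint a b 0 t := by
  have ha := h.a_pos
  have hb := h.one_lt_b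
  have ha1 := h.a_lt
  have hba : 0 < b - a := by linarith
  choose c t hct using fun n => h.exists_eq_eigPoint (z n)
  have hw : 0 < 1 / ((1 + a) * (1 + b)) := by positivity
  have hfst : Tendsto (fun n => (z n).1 - 1 / ((1 + a) * (1 + b))) atTop (𝓝 0) := by
    have := ((continuous_fst.tendsto _).comp hlim).sub_const (1 / ((1 + a) * (1 + b)))
    simpa [eigPoint] using this
  have hstab : Tendsto (fun n => stableFun b (z n)) atTop (𝓝 0) := by
    have hcont : Continuous (stableFun b) := by unfold stableFun; fun_prop
    have := (hcont.tendsto _).comp hlim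
    rwa [h.stableFun_eigPoint, mul_zero] at this
  have ht : Tendsto t atTop (𝓝 0) := by
    have e : t = fun n => stableFun b (z n) * (a - b)⁻¹ := by
      ext n
      rw [hct n, h.stableFun_eigPoint]
      have : a - b ≠ 0 := by linarith
      field_simp
    rw [e]
    simpa using hstab.mul_const (a - b)⁻¹
  have hc : Tendsto c atTop (𝓝 0) := by
    have e : c = fun n => ((z n).1 - 1 / ((1 + a) * (1 + b))) - t n := by
      ext n
      rw [hct n]
      simp only [eigPoint]
      ring
    rw [e]
    simpa using hfst.sub ht
  have hev : ∀ᶠ n in atTop, -(1 / ((1 + a) * (1 + b))) < (z n).1 - 1 / ((1 + a) * (1 + b)) :=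
    hfst.eventually (lt_mem_nhds (by linarith))
  obtain ⟨N, hN⟩ := eventually_atTop.1 hev
  have hstep : ∀ n ≥ N, c n = -a * c (n + 1) := by
    intro n hn
    have h1 := hN (n + 1) (by omega)
    have h2 := hz n
    rw [hct (n + 1)] at h1 h2
    rw [h.eigMap_eigPoint (by simp only [eigPoint] at h1; linarith), hct n] at h2
    simp only [eigPoint, Prod.mk.injEq] at h2
    obtain ⟨h3, h4⟩ := h2
    have : (b - a) * (c n - -a * c (n + 1)) = 0 := by linear_combination a * h3 - h4
    rcases mul_eq_zero.1 this with h5 | h5 <;> linarith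
  have hzero : ∀ n ≥ N, c n = 0 := by
    intro n hn
    have hpow : ∀ k, c n = (-a) ^ k * c (n + k) := by
      intro k
      induction k with
      | zero => simp
      | succ k ih =>
        rw [ih, hstep (n + k) (by omega), ← add_assoc]
        ring
    have hle : ∀ k, |c n| ≤ |c (n + k)| := by
      intro k
      rw [hpow k, abs_mul, abs_pow, abs_neg, abs_of_pos ha]
      exact mul_le_of_le_one_left (abs_nonneg _) (pow_le_one₀ ha.le ha1.le)
    have hlim0 : Tendsto (fun k => |c (n + k)|) atTop (𝓝 0) := by
      have := (hc.comp (tendsto_add_atTop_nat n)).abs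
      simpa [Function.comp_def, add_comm] using this
    exact abs_nonpos_iff.1 (ge_of_tendsto' hlim0 hle)
  have htd : ∀ᶠ n in atTop, |t n| < d := by
    have := ht.abs
    rw [abs_zero] at this
    exact this.eventually (gt_mem_nhds hd)
  filter_upwards [htd, eventually_ge_atTop N] with n hn hnN
  exact ⟨t n, hn, by rw [hct n, hzero n hnN]⟩

/-- Images of an open set meeting the stable set near the right fixed point accumulate on the
local unstable line. -/
lemma eventually_exists_iterate_mem (h : SaddleParams a b s u) {U V : Set (ℝ × ℝ)}
    (hU : IsOpen U) (hV : IsOpen V) {c t : ℝ} (hc : |c| < 1 / ((1 + a) * (1 + b)) / 2)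
    (ht : |t| < 1 / ((1 + a) * (1 + b)) / 2) (hcU : eigPoint a b c 0 ∈ U)
    (htV : eigPoint a b 0 t ∈ V) :
    ∀ᶠ k : ℕ in atTop, ∃ p ∈ U, (eigMap a b s u)^[k] p ∈ V := by
  have ha := h.a_pos
  have hb := h.one_lt_b
  have ha1 := h.a_lt
  have hcont := continuous_eigPoint a b
  have hb' : |(-b)⁻¹| < 1 := by
    rw [abs_inv, abs_neg, abs_of_pos (by linarith)]
    exact inv_lt_one_of_one_lt₀ hb
  have ha' : |-a| < 1 := by rwa [abs_neg, abs_of_pos ha]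
  have h1 : ∀ᶠ k : ℕ in atTop, eigPoint a b c ((-b)⁻¹ ^ k * t) ∈ U := by
    have := (hcont.tendsto (c, 0)).comp
      ((tendsto_const_nhds (x := c)).prodMk_nhds (tendsto_pow_mul_zero hb' t))
    exact this.eventually (hU.mem_nhds hcU)
  have h2 : ∀ᶠ k : ℕ in atTop, eigPoint a b ((-a) ^ k * c) t ∈ V := by
    have := (hcont.tendsto (0, t)).comp
      ((tendsto_pow_mul_zero ha' c).prodMk_nhds (tendsto_const_nhds (x := t)))
    exact this.eventually (hV.mem_nhds htV)
  filter_upwards [h1, h2] with k hk1 hk2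
  refine ⟨_, hk1, ?_⟩
  have hb0 : -b ≠ 0 := by linarith
  rw [h.iterate_eigPoint]
  · have e : (-b) ^ k * ((-b)⁻¹ ^ k * t) = t := by
      rw [← mul_assoc, ← mul_pow, mul_inv_cancel₀ hb0, one_pow, one_mul]
    rwa [e]
  · intro j hj
    have e : (-b) ^ j * ((-b)⁻¹ ^ k * t) = (-b)⁻¹ ^ (k - j) * t := by
      obtain ⟨i, rfl⟩ := Nat.exists_eq_add_of_lt hj
      have : j + i + 1 - j = i + 1 := by omega
      rw [this, add_assoc, pow_add, ← mul_assoc, ← mul_assoc, ← mul_pow, mul_inv_cancel₀ hb0,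
        one_pow, one_mul]
    rw [e]
    have l1 : |(-a) ^ j * c| ≤ |c| := by
      rw [abs_mul, abs_pow]
      exact mul_le_of_le_one_left (abs_nonneg _) (pow_le_one₀ (abs_nonneg _) ha'.le)
    have l2 : |(-b)⁻¹ ^ (k - j) * t| ≤ |t| := by
      rw [abs_mul, abs_pow]
      exact mul_le_of_le_one_left (abs_nonneg _) (pow_le_one₀ (abs_nonneg _) hb'.le)
    have l3 := neg_abs_le ((-a) ^ j * c)
    have l4 := neg_abs_le ((-b)⁻¹ ^ (k - j) * t)
    linarith

/-- An open set containing a point of the local unstable line in the interior of the trapping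
region has an iterated preimage meeting the stable line close to the right fixed point. -/
lemma exists_iterate_near (h : SaddleParams a b s u) {U : Set (ℝ × ℝ)} (hU : IsOpen U) {t : ℝ}
    (htU : eigPoint a b 0 t ∈ U) (htrap : U ⊆ trapRegion a b s u) :
    ∃ n : ℕ, ∃ q ∈ U, ∃ c, |c| < 1 / ((1 + a) * (1 + b)) / 2 ∧
      (eigMap a b s u)^[n] q = eigPoint a b c 0 := by
  have ha := h.a_pos
  have hb := h.one_lt_b
  have ha1 := h.a_lt
  have ha' : |-a| < 1 := by rwa [abs_neg, abs_of_pos ha]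
  have hw : 0 < 1 / ((1 + a) * (1 + b)) := by positivity
  obtain ⟨l, hl, hseg⟩ : ∃ l > 0, ConeSegmentTo a s U (eigPoint a b 0 t) l := by
    have hc : Continuous fun r : ℝ => ((eigPoint a b 0 t).1 - r, (eigPoint a b 0 t).2 - a * r) := by
      fun_prop
    have h0 := (hU.preimage hc).mem_nhds (x := (0 : ℝ)) (by simpa using htU)
    obtain ⟨l, hl, hball⟩ := Metric.mem_nhds_iff.1 h0
    refine ⟨l / 2, by positivity, a, by linarith [h.s_pos], le_rfl, fun r hr hrl => ?_⟩
    have : r ∈ Metric.ball (0 : ℝ) l := by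
      rw [mem_ball_zero_iff, Real.norm_eq_abs, abs_of_nonneg hr]
      linarith
    exact hball this
  obtain ⟨n, q, hq, hq0⟩ := h.exists_iterate_stable htrap hl hseg
  obtain ⟨c, t', hct⟩ := h.exists_eq_eigPoint ((eigMap a b s u)^[n] q)
  have ht' : t' = 0 := by
    rw [hct, h.stableFun_eigPoint] at hq0
    rcases mul_eq_zero.1 hq0 with h1 | h1
    · linarith
    · exact h1
  subst ht'
  have hin : eigPoint a b c 0 ∈ trapRegion a b s u := by
    rw [← hct]
    exact h.mapsTo_trapRegion.iterate n (htrap hq)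
  have hiter : ∀ k, (eigMap a b s u)^[k] (eigPoint a b c 0) = eigPoint a b ((-a) ^ k * c) 0 := by
    intro k
    induction k with
    | zero => simp
    | succ k ih =>
      have hk : eigPoint a b ((-a) ^ k * c) 0 ∈ trapRegion a b s u := by
        rw [← ih]
        exact h.mapsTo_trapRegion.iterate k hin
      have hpos := h.fst_pos_of_stableFun_eq_zero hk (by rw [h.stableFun_eigPoint, mul_zero])
      rw [Function.iterate_succ_apply', ih, h.eigMap_eigPoint hpos.le]
      congr 1 <;> ring
  have hsmall := (tendsto_pow_mul_zero ha' c).abs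
  rw [abs_zero] at hsmall
  obtain ⟨k, hk⟩ := (hsmall.eventually (gt_mem_nhds (half_pos hw))).exists
  exact ⟨k + n, q, hq, _, hk, by rw [Function.iterate_add_apply, hct, hiter]⟩

lemma transitive (h : SaddleParams a b s u) {g : ℝ × ℝ → ℝ × ℝ}
    (hg1 : Function.LeftInverse g (eigMap a b s u))
    (hg2 : Function.RightInverse g (eigMap a b s u)) {M N : Set (ℝ × ℝ)}
    (hM : IsOpen M) (hN : IsOpen N) {z w : ℝ × ℝ} (hz : z ∈ M) (hw : w ∈ N)
    (hzX : Tendsto (fun n : ℕ => g^[n] z) atTop (𝓝 (eigPoint a b 0 0)))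
    (hwX : Tendsto (fun n : ℕ => g^[n] w) atTop (𝓝 (eigPoint a b 0 0))) :
    ∃ n : ℕ, ((eigMap a b s u)^[n] '' M ∩ N).Nonempty := by
  have ha := h.a_pos
  have hb := h.one_lt_b
  have hu := h.one_lt_u
  have hs := h.s_pos
  have hw0 : 0 < 1 / ((1 + a) * (1 + b)) / 2 := by positivity
  have hF := continuous_eigMap a b s u
  have hg : Continuous g := by
    obtain ⟨g', hg', hr⟩ := exists_continuous_rightInverse_eigMap (a := a) (b := b) (s := s) (u := u)
      (by positivity) (by positivity)
    rwa [hg1.eq_rightInverse hr]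
  have hback : ∀ x : ℝ × ℝ, ∀ n, eigMap a b s u (g^[n + 1] x) = g^[n] x := fun x n => by
    rw [Function.iterate_succ_apply', hg2]
  obtain ⟨m, hm1, t, -, hm2⟩ :=
    ((hzX.eventually (interior_mem_nhds.2 h.trapRegion_mem_nhds)).and
      (h.eventually_unstable (hback z) hzX hw0)).exists
  obtain ⟨l, t', ht', hl⟩ := (h.eventually_unstable (hback w) hwX hw0).exists
  set U := (eigMap a b s u)^[m] ⁻¹' M ∩ interior (trapRegion a b s u) with hUdef
  have hU : IsOpen U := (hM.preimage (hF.iterate m)).inter isOpen_interior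
  have hV : IsOpen ((eigMap a b s u)^[l] ⁻¹' N) := hN.preimage (hF.iterate l)
  have htU : eigPoint a b 0 t ∈ U := by
    rw [← hm2]
    exact ⟨by rwa [Set.mem_preimage, hg2.iterate m], hm1⟩
  have htV : eigPoint a b 0 t' ∈ (eigMap a b s u)^[l] ⁻¹' N := by
    rw [← hl, Set.mem_preimage, hg2.iterate l]
    exact hw
  obtain ⟨n, q, hq, c, hc, hqc⟩ :=
    h.exists_iterate_near hU htU (Set.inter_subset_right.trans interior_subset)
  have hcU : eigPoint a b c 0 ∈ g^[n] ⁻¹' U := by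
    rw [← hqc, Set.mem_preimage, hg1.iterate n]
    exact hq
  obtain ⟨k, ⟨p, hp, hpV⟩, hkm⟩ :=
    ((h.eventually_exists_iterate_mem (hU.preimage (hg.iterate n)) hV hc ht' hcU htV).and
      (eventually_ge_atTop m)).exists
  obtain ⟨i, rfl⟩ := Nat.exists_eq_add_of_le' hkm
  refine ⟨l + (i + n), _, ⟨_, hp.1, rfl⟩, ?_⟩
  rw [Set.mem_preimage] at hpV
  convert hpV using 1
  have e : p = (eigMap a b s u)^[n] (g^[n] p) := (hg2.iterate n p).symm
  conv_rhs => rw [e]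
  simp only [← Function.iterate_add_apply]
  congr 1
  omega

end SaddleParams

/-- The roots of the characteristic polynomial of a saddle whose unstable multiplier exceeds
`√2`. -/
lemma exists_roots {τ δ : ℝ} (hδ : 0 < δ) (hτ : δ + 1 < τ) (hτ2 : δ + 2 < τ * Real.sqrt 2) :
    ∃ u s : ℝ, Real.sqrt 2 < u ∧ (0 < s ∧ s < 1) ∧ τ = u + s ∧ δ = u * s ∧
      (τ + Real.sqrt (τ ^ 2 - 4 * δ)) / 2 = u := by
  have hr2 : Real.sqrt 2 * Real.sqrt 2 = 2 := Real.mul_self_sqrt (by norm_num)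
  have hr1 : 1 < Real.sqrt 2 := by rw [Real.lt_sqrt] <;> norm_num
  have hdisc : 0 ≤ τ ^ 2 - 4 * δ := by nlinarith [sq_nonneg (δ - 1)]
  have hd2 := Real.mul_self_sqrt hdisc
  have hd0 := Real.sqrt_nonneg (τ ^ 2 - 4 * δ)
  set d := Real.sqrt (τ ^ 2 - 4 * δ)
  have hprod : δ = (τ + d) / 2 * ((τ - d) / 2) := by nlinarith
  have hu0 : 0 < (τ + d) / 2 := by linarith
  have hs0 : 0 < (τ - d) / 2 := pos_of_mul_pos_right (hprod ▸ hδ) hu0.le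
  have hs1 : (τ - d) / 2 < 1 := by
    by_contra! hc
    nlinarith [mul_nonneg (sub_nonneg.2 hc) (show 0 ≤ (τ + d) / 2 - 1 by linarith)]
  refine ⟨(τ + d) / 2, (τ - d) / 2, ?_, ⟨hs0, hs1⟩, by ring, hprod, rfl⟩
  by_contra! hc
  nlinarith [mul_nonneg (sub_nonneg.2 hc)
    (show 0 ≤ Real.sqrt 2 - (τ - d) / 2 by linarith)]

/-- `f` is topologically transitive on the closure of the
unstable manifold `W^u(X)`. -/
theorem stmt17 (τL δL τR δR lamLu : ℝ)
    (hδL : 0 < δL) (hδR : 0 < δR)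
    (hτL : τL > δL + 1) (hτR : τR < -(δR + 1))
    (hτL2 : τL > (δL + 2) / Real.sqrt 2) (hτR2 : τR < -((δR + 2) / Real.sqrt 2))
    (hlamLu : lamLu = (τL + Real.sqrt (τL ^ 2 - 4 * δL)) / 2)
    (hφ : 0 < δR - (τR + δL + δR - (1 + τR) * lamLu) * lamLu)
    (F finv : ℝ × ℝ → ℝ × ℝ)
    (hF : F = bcnf τL δL τR δR)
    (hinv1 : Function.LeftInverse finv F) (hinv2 : Function.RightInverse finv F)
    (X : ℝ × ℝ)
    (hX : X = (1 / (δR + 1 - τR), -δR / (δR + 1 - τR)))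
    (Wu : Set (ℝ × ℝ))
    (hWu : Wu = {z : ℝ × ℝ |
      Filter.Tendsto (fun n : ℕ => finv^[n] z) Filter.atTop (nhds X)}) :
    ∀ M N : Set (ℝ × ℝ), IsOpen M → IsOpen N →
      (M ∩ closure Wu).Nonempty → (N ∩ closure Wu).Nonempty →
      ∃ n : ℕ, (F^[n] '' M ∩ N).Nonempty := by
  intro M N hM hN hMW hNW
  obtain ⟨z, hzM, hz⟩ := (closure_inter_open_nonempty_iff hM).1 (by rwa [Set.inter_comm])
    |>.imp fun _ hx => hx.symm
  obtain ⟨w, hwN, hw⟩ := (closure_inter_open_nonempty_iff hN).1 (by rwa [Set.inter_comm])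
    |>.imp fun _ hx => hx.symm
  rw [hWu] at hz hw
  have hr0 : 0 < Real.sqrt 2 := by positivity
  rw [gt_iff_lt, div_lt_iff₀ hr0] at hτL2
  rw [← neg_div, lt_div_iff₀ hr0] at hτR2
  obtain ⟨u, s, hu, hs, hus, hp, hlam⟩ := exists_roots hδL hτL (by linarith)
  obtain ⟨b, a, hb, ha, hba, hp', -⟩ := exists_roots hδR (τ := -τR) (by linarith) (by linarith)
  obtain rfl : lamLu = u := hlamLu.trans hlam
  obtain ⟨hs0, hs1⟩ := hs
  obtain ⟨ha0, ha1⟩ := ha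
  obtain rfl : τL = lamLu + s := hus
  obtain rfl : δL = lamLu * s := hp
  obtain rfl : δR = a * b := by rw [hp', mul_comm]
  obtain rfl : τR = -(a + b) := by linarith
  have h : SaddleParams a b s lamLu := ⟨ha0, ha1, hb, hs0, hs1, hu, by linarith⟩
  obtain rfl : F = eigMap a b s lamLu := hF
  have hX' : X = eigPoint a b 0 0 := by
    have hb0 := h.one_lt_b
    have e : a * b + 1 - -(a + b) = (1 + a) * (1 + b) := by ring
    rw [hX, e]
    simp [eigPoint]
  subst hX'
  exact h.transitive hinv1 hinv2 hM hN hzM hwN hz hw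
end

section
/- Assume the basic parameter conditions δ_L > 0, δ_R > 0, τ_L > δ_L + 1, τ_R < -(δ_R + 1), the additional conditions τ_L > (δ_L + 2)/√2 and τ_R < -(δ_R + 2)/√2, and φ > 0. Then C₁ < -1/λ_R^s, and consequently D₁ < -1/λ_R^s, which is equivalent to 1 - λ_L^s + λ_R^s > 0. -/
/-- If `τ > δ + 1` and `δ > 0`, the roots of `x ^ 2 - τ x + δ` lie on either side of `1`; if moreover
`τ > (δ + 2) / √2`, the larger root exceeds `√2`. -/
lemma exists_roots_of_saddle {τ δ : ℝ} (hδ : 0 < δ) (hτ : δ + 1 < τ)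
    (hτ' : (δ + 2) / Real.sqrt 2 < τ) :
    ∃ s u : ℝ, s = (τ - Real.sqrt (τ ^ 2 - 4 * δ)) / 2 ∧
      u = (τ + Real.sqrt (τ ^ 2 - 4 * δ)) / 2 ∧
      s + u = τ ∧ s * u = δ ∧ 0 < s ∧ s < 1 ∧ Real.sqrt 2 < u := by
  have hdisc : (δ - 1) ^ 2 < τ ^ 2 - 4 * δ := by nlinarith
  have hsq : Real.sqrt (τ ^ 2 - 4 * δ) ^ 2 = τ ^ 2 - 4 * δ :=
    Real.sq_sqrt ((sq_nonneg _).trans hdisc.le)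
  have hroot : 0 ≤ Real.sqrt (τ ^ 2 - 4 * δ) := Real.sqrt_nonneg _
  generalize Real.sqrt (τ ^ 2 - 4 * δ) = d at hsq hroot
  obtain ⟨s, hs⟩ : ∃ s, s = (τ - d) / 2 := ⟨_, rfl⟩
  obtain ⟨u, hu⟩ : ∃ u, u = (τ + d) / 2 := ⟨_, rfl⟩
  have hsum : s + u = τ := by rw [hs, hu]; ring
  have hprod : s * u = δ := by rw [hs, hu]; linear_combination -hsq / 4
  have hsu : s ≤ u := by rw [hs, hu]; linarith
  have hupos : 0 < u := by linarith
  have hspos : 0 < s := pos_of_mul_pos_left (hprod ▸ hδ) hupos.le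
  have hs1 : s < 1 := by
    by_contra! h
    nlinarith [mul_nonneg (sub_nonneg.2 h) (sub_nonneg.2 (h.trans hsu))]
  have h2 : (0 : ℝ) < Real.sqrt 2 := by positivity
  have h2sq : Real.sqrt 2 ^ 2 = 2 := Real.sq_sqrt (by norm_num)
  have h2one : 1 < Real.sqrt 2 := by nlinarith
  rw [div_lt_iff₀ h2] at hτ'
  have hfac : 0 < (u - Real.sqrt 2) * (Real.sqrt 2 - s) := by
    have : (u - Real.sqrt 2) * (Real.sqrt 2 - s) = τ * Real.sqrt 2 - (δ + 2) := by
      rw [← hsum, ← hprod]; linear_combination -h2sq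
    linarith
  exact ⟨s, u, hs, hu, hsum, hprod, hspos, hs1,
    sub_pos.1 (pos_of_mul_pos_left hfac (by linarith))⟩

lemma mul_lt_of_sqrt_two_lt {r R u : ℝ} (hr : 0 < r) (hr1 : r < 1) (hR : Real.sqrt 2 < R)
    (hu : Real.sqrt 2 < u) : r * u < R * ((u - 1) * (u + r)) := by
  have h2sq : Real.sqrt 2 ^ 2 = 2 := Real.sq_sqrt (by norm_num)
  have h2 : (0 : ℝ) < Real.sqrt 2 := by positivity
  have h2one : 1 < Real.sqrt 2 := by nlinarith
  generalize Real.sqrt 2 = q at *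
  have hpos : 0 < (u - 1) * (u + r) := mul_pos (by linarith) (by linarith)
  have hone : u < q * ((u - 1) * (u + 1)) := by
    have : q * ((u - 1) * (u + 1)) - u = (u - q) * (q * u + 1) := by
      linear_combination u * h2sq
    have : 0 < (u - q) * (q * u + 1) :=
      mul_pos (sub_pos.2 hu) (add_pos (mul_pos h2 (h2.trans hu)) one_pos)
    linarith
  have hscale : r * u < q * ((u - 1) * (u + r)) := by
    have h₁ := mul_lt_mul_of_pos_left hone hr
    have : 0 < q * ((u - 1) * (u * (1 - r))) :=
      mul_pos h2 (mul_pos (by linarith) (mul_pos (by linarith) (by linarith)))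
    linarith
  exact hscale.trans (mul_lt_mul_of_pos_right hR hpos)


/-- `C₁ < -1/λ_R^s`, consequently `D₁ < -1/λ_R^s`, which is
equivalent to `1 - λ_L^s + λ_R^s > 0`. -/
theorem stmt19 (τL δL τR δR lamLs lamLu lamRs D1 S2 C1 : ℝ)
    (hδL : 0 < δL) (hδR : 0 < δR)
    (hτL : τL > δL + 1) (hτR : τR < -(δR + 1))
    (hτL2 : τL > (δL + 2) / Real.sqrt 2) (hτR2 : τR < -((δR + 2) / Real.sqrt 2))
    (hlamLs : lamLs = (τL - Real.sqrt (τL ^ 2 - 4 * δL)) / 2)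
    (hlamLu : lamLu = (τL + Real.sqrt (τL ^ 2 - 4 * δL)) / 2)
    (hlamRs : lamRs = (τR + Real.sqrt (τR ^ 2 - 4 * δR)) / 2)
    (hD1 : D1 = 1 / (1 - lamLs))
    (hS2 : S2 = -lamLu / (lamLu - 1))
    (hC1 : C1 = -S2 / (δR - τR + δR / S2))
    (hφ : 0 < δR - (τR + δL + δR - (1 + τR) * lamLu) * lamLu) :
    C1 < -1 / lamRs ∧ D1 < -1 / lamRs ∧ (D1 < -1 / lamRs ↔ 1 - lamLs + lamRs > 0) := by
  obtain ⟨s, u, hs, hu, hsu, hsu', hs0, hs1, hu2⟩ := exists_roots_of_saddle hδL hτL hτL2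
  obtain ⟨r, R, hr, -, hrR, hrR', hr0, hr1, hR2⟩ :=
    exists_roots_of_saddle (τ := -τR) hδR (by linarith) (by linarith)
  replace hlamRs : lamRs = -r := by rw [hlamRs, hr, neg_sq]; ring
  rw [← hs] at hlamLs
  rw [← hu] at hlamLu
  subst lamLs lamLu lamRs
  obtain rfl : τR = -(r + R) := by linarith
  subst δL δR
  have hkey := mul_lt_of_sqrt_two_lt hr0 hr1 hR2 hu2
  have hu1 : 1 < u := ((Real.lt_sqrt zero_le_one).2 (by norm_num)).trans hu2
  have hu0 : 0 < u := one_pos.trans hu1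
  have hR0 : 0 < R := (Real.sqrt_nonneg 2).trans_lt hR2
  have hcond : 0 < 1 - s - r :=
    pos_of_mul_pos_right (b := 1 - s - r) (a := u ^ 2) (by linarith) (sq_nonneg u)
  rw [neg_div_neg_eq]
  have hD : D1 < 1 / r := by
    rw [hD1]
    exact one_div_lt_one_div_of_lt hr0 (by linarith)
  refine ⟨?_, hD, fun _ => by linarith, fun _ => hD⟩
  have hden : 0 < (u - 1) * ((r + R) * u + r * R) :=
    mul_pos (sub_pos.2 hu1) (by positivity)
  have hC : C1 = u ^ 2 / ((u - 1) * ((r + R) * u + r * R)) := by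
    have hu1' : u - 1 ≠ 0 := (sub_pos.2 hu1).ne'
    have hmid : r * R - -(r + R) + r * R / S2 = ((r + R) * u + r * R) / u := by
      rw [hS2]
      field_simp
      ring
    rw [hC1, hmid, hS2]
    field_simp
  rw [hC, div_lt_div_iff₀ hden hr0]
  linarith
end
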